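/- arXiv:2112.07960 — 2 statements merged into one kernel-verified Lean document; each statement's English description precedes it below -/
import Mathlib

section
/- Under Assumption A, Assumption C, and the assumption that every function c_i^ℓ (i ∈ N, ℓ ∈ L_0) is bounded, the constrained stochastic game possesses a Nash equilibrium in the set Φ of stationary multi-strategies. -/
open MeasureTheory ProbabilityTheory Filter Topology
open scoped ENNReal NNReal

namespace CSGame

/-- The joint action space of the players. -/
abbrev JA {n : ℕ} (A : Fin n → Type) : Type := (i : Fin n) → A i

/-- The data of a constrained discounted stochastic Markov game:
countable state space `X`, Borel action spaces `A i` with compact admissible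
action sets `As i x`, transition probability `p`, initial distribution `η`,
discount factor `α`, cost/constraint functions `c i ℓ` (`ℓ = 0` is the cost,
`ℓ ∈ L = {1,…,l}` are the constraints) and constraint bounds `κ i ℓ`. -/
structure GameData (n l : ℕ) (X : Type) (A : Fin n → Type)
    [MeasurableSpace X] [∀ i, MeasurableSpace (A i)] [∀ i, TopologicalSpace (A i)] where
  As : (i : Fin n) → X → Set (A i)
  p : X → JA A → Measure X
  η : Measure X
  α : ℝ
  c : Fin n → Fin (l + 1) → X → JA A → ℝ
  κ : Fin n → Fin (l + 1) → ℝ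
  hAs_ne : ∀ i x, (As i x).Nonempty
  hAs_cpt : ∀ i x, IsCompact (As i x)
  hp : ∀ x a, IsProbabilityMeasure (p x a)
  hpm : ∀ x y, Measurable fun a => p x a {y}
  hη : IsProbabilityMeasure η
  hα0 : 0 < α
  hα1 : α < 1
  hc : ∀ i ℓ x, Measurable (c i ℓ x)

variable {n l : ℕ}
variable {X : Type} [Countable X] [MeasurableSpace X] [DiscreteMeasurableSpace X]
  [TopologicalSpace X] [DiscreteTopology X] [BorelSpace X] [SecondCountableTopology X]
variable {A : Fin n → Type} [∀ i, MeasurableSpace (A i)] [∀ i, TopologicalSpace (A i)]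
  [∀ i, PolishSpace (A i)] [∀ i, BorelSpace (A i)]

/-- The set of feasible action profiles in state `x` (the section of `𝕂` at `x`). -/
def jointSet (G : GameData n l X A) (x : X) : Set (JA A) :=
  Set.univ.pi fun i => G.As i x

/-- Histories of the game: `Hist X AA t` records the initial state and `t`
state-action transitions, ending with the current state (this is `H^{t+1}`). -/
def Hist (X AA : Type) : ℕ → Type
  | 0 => X
  | t + 1 => Hist X AA t × AA × X

noncomputable instance histMS (X AA : Type) [MeasurableSpace X] [MeasurableSpace AA] :
    ∀ t, MeasurableSpace (Hist X AA t)
  | 0 => inferInstanceAs (MeasurableSpace X)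
  | t + 1 =>
      letI := histMS X AA t
      inferInstanceAs (MeasurableSpace (Hist X AA t × AA × X))

/-- The current (last) state of a history. -/
def lastState (X AA : Type) : ∀ t, Hist X AA t → X
  | 0, h => h
  | _ + 1, h => h.2.2

theorem measurable_lastState (X AA : Type) [MeasurableSpace X] [MeasurableSpace AA] :
    ∀ t, Measurable (lastState X AA t)
  | 0 => measurable_id
  | _ + 1 => measurable_snd.comp measurable_snd

variable (G : GameData n l X A)

/-- A (history dependent, randomised) strategy of player `i`: a sequence of
transition probabilities from histories to the action space of player `i`,
concentrated on the admissible action set at the current state. -/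
structure Strategy (i : Fin n) where
  f : ∀ t, Hist X (JA A) t → ProbabilityMeasure (A i)
  meas : ∀ t (s : Set (A i)), MeasurableSet s →
    Measurable fun h => (f t h : Measure (A i)) s
  supp : ∀ t h, f t h (G.As i (lastState X (JA A) t h)) = 1

/-- A stationary strategy of player `i`: a transition probability from states to
actions, concentrated on the admissible action set. -/
def Stat (i : Fin n) : Type :=
  {φ : X → ProbabilityMeasure (A i) // ∀ x, φ x (G.As i x) = 1}

noncomputable instance (i : Fin n) : TopologicalSpace (Stat G i) :=
  inferInstanceAs (TopologicalSpace
    {φ : X → ProbabilityMeasure (A i) // ∀ x, φ x (G.As i x) = 1})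

/-- Multi-strategies: one strategy for each player. -/
abbrev MultiStrategy : Type _ := ∀ i, Strategy G i

/-- Stationary multi-strategies (the set `Φ`). -/
abbrev StatProfile : Type _ := ∀ i, Stat G i

noncomputable instance : TopologicalSpace (StatProfile G) :=
  inferInstanceAs (TopologicalSpace (∀ i, Stat G i))

/-- The strategy induced by a stationary strategy. -/
noncomputable def ofStat (i : Fin n) (φ : Stat G i) : Strategy G i where
  f := fun t h => φ.1 (lastState X (JA A) t h)
  meas := fun t _s _hs =>
    (Measurable.of_discrete (f := fun x => (φ.1 x : Measure (A i)) _s)).comp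
      (measurable_lastState X (JA A) t)
  supp := fun t h => φ.2 _

/-- The multi-strategy induced by a stationary multi-strategy. -/
noncomputable def ofStatAll (φ : StatProfile G) : MultiStrategy G :=
  fun i => ofStat G i (φ i)

/-- `[π_{-i}, σ]` : player `i` deviates to `σ`, the others keep `π`. -/
noncomputable def combine (π : MultiStrategy G) (i : Fin n) (σ : Strategy G i) :
    MultiStrategy G :=
  Function.update π i σ

/-- `[φ_{-i}, γ]` for stationary profiles. -/
noncomputable def updStat (φ : StatProfile G) (i : Fin n) (γ : Stat G i) :
    StatProfile G :=
  Function.update φ i γ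

/-- The joint (product) distribution of the players' actions after history `h`. -/
noncomputable def jointLaw (π : MultiStrategy G) (t : ℕ) (h : Hist X (JA A) t) :
    Measure (JA A) :=
  Measure.pi fun i => ((π i).f t h : Measure (A i))

/-- The distribution of histories of length `t` under the multi-strategy `π`,
the transition probability `G.p` and the initial distribution `η'`
(the finite-dimensional marginals of the Ionescu–Tulcea measure `P^π_{η'}`). -/
noncomputable def histMeas (η' : Measure X) (π : MultiStrategy G) :
    ∀ t, Measure (Hist X (JA A) t)
  | 0 => η'
  | t + 1 =>
      (histMeas η' π t).bind fun h =>
        (jointLaw G π t h).bind fun a =>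
          (G.p (lastState X (JA A) t h) a).map fun y =>
            (show Hist X (JA A) (t + 1) from (h, a, y))

/-- Expected value of `f (x^{t+1}, a^{t+1})` under `π` (states enumerated from `1`
in the paper, from `0` here). -/
noncomputable def stageExp (η' : Measure X) (π : MultiStrategy G) (t : ℕ)
    (f : X → JA A → ℝ) : ℝ :=
  ∫ h, (∫ a, f (lastState X (JA A) t h) a ∂(jointLaw G π t h)) ∂(histMeas G η' π t)

/-- The expected discounted cost functional
`J(π) = (1-α) E^π_{η'} [∑_{t≥1} α^{t-1} f(x^t,a^t)]`. -/
noncomputable def Jfun (η' : Measure X) (f : X → JA A → ℝ) (π : MultiStrategy G) : ℝ :=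
  (1 - G.α) * ∑' t : ℕ, G.α ^ t * stageExp G η' π t f

/-- `J_i^ℓ(π)` of the paper. -/
noncomputable def J (i : Fin n) (ℓ : Fin (l + 1)) (π : MultiStrategy G) : ℝ :=
  Jfun G G.η (G.c i ℓ) π

/-- `π_i ∈ Δ_i(π_{-i})` : all constraints of player `i` are satisfied. -/
def Feas (i : Fin n) (π : MultiStrategy G) : Prop :=
  ∀ ℓ : Fin (l + 1), ℓ ≠ 0 → J G i ℓ π ≤ G.κ i ℓ

/-- Expectation of `w(x^{t+1})` (as an extended nonnegative real). -/
noncomputable def wStateExp (η' : Measure X) (π : MultiStrategy G) (t : ℕ)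
    (w : X → ℝ) : ℝ≥0∞ :=
  ∫⁻ h, ENNReal.ofReal (w (lastState X (JA A) t h)) ∂(histMeas G η' π t)

/-- Assumption A(i): continuity of the transition probability in the actions. -/
def AssumptionA1 : Prop :=
  ∀ x y, ContinuousOn (fun a => G.p x a {y}) (jointSet G x)

/-- Assumption A: continuity of the transition probability and of the
cost/constraint functions in the actions. -/
def AssumptionA : Prop :=
  AssumptionA1 G ∧ ∀ i ℓ x, ContinuousOn (G.c i ℓ x) (jointSet G x)

/-- Assumption B for the weight function `w`: `w ≥ 1` bounds all the costs on `𝕂`,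
the discounted tails `sup_π (1-α) E^π_η[∑_{t≥k} α^{t-1} w(x^t)]` vanish as `k → ∞`,
and for each stage `t` the family `{w(x^t)}` is uniformly integrable over all
multi-strategies. -/
def AssumptionB (w : X → ℝ) : Prop :=
  (∀ x, 1 ≤ w x) ∧
  (∀ i ℓ x a, a ∈ jointSet G x → |G.c i ℓ x a| ≤ w x) ∧
  Tendsto (fun k : ℕ => ⨆ π : MultiStrategy G,
      ENNReal.ofReal (1 - G.α) *
        ∑' t : ℕ, ENNReal.ofReal G.α ^ (k + t) * wStateExp G G.η π (k + t) w)
    atTop (𝓝 0) ∧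
  ∀ t : ℕ, Tendsto (fun k : ℕ => ⨆ π : MultiStrategy G,
      ∫⁻ h in {h | (k : ℝ) ≤ w (lastState X (JA A) t h)},
        ENNReal.ofReal (w (lastState X (JA A) t h)) ∂(histMeas G G.η π t))
    atTop (𝓝 0)

/-- Assumption C (Slater condition). -/
def AssumptionC : Prop :=
  ∀ (φ : StatProfile G) (i : Fin n), ∃ π : Strategy G i,
    ∀ ℓ : Fin (l + 1), ℓ ≠ 0 → J G i ℓ (combine G (ofStatAll G φ) i π) < G.κ i ℓ

/-- Assumption D: the initial distribution charges every state. -/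
def AssumptionD : Prop :=
  ∀ x : X, 0 < G.η {x}

/-- Assumption W (weighted-norm conditions of Wessels). -/
def AssumptionW (w : X → ℝ) : Prop :=
  (∀ x, 1 ≤ w x) ∧
  (∀ i ℓ x a, a ∈ jointSet G x → |G.c i ℓ x a| ≤ w x) ∧
  (∃ δ : ℝ, 1 ≤ δ ∧ δ * G.α < 1 ∧ ∀ x a, a ∈ jointSet G x →
      ∫⁻ y, ENNReal.ofReal (w y) ∂(G.p x a) ≤ ENNReal.ofReal (δ * w x)) ∧
  (∀ x, ContinuousOn (fun a => ∫⁻ y, ENNReal.ofReal (w y) ∂(G.p x a)) (jointSet G x)) ∧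
  (∫⁻ y, ENNReal.ofReal (w y) ∂G.η) < ⊤

/-- All cost and constraint functions are bounded. -/
def BoundedCosts : Prop :=
  ∀ i (ℓ : Fin (l + 1)), ∃ C : ℝ, ∀ x a, |G.c i ℓ x a| ≤ C

/-- A stationary multi-strategy `φ` is a Nash equilibrium of the constrained game:
it is feasible, and no player can lower his discounted cost by a unilateral
deviation to any (history dependent) strategy satisfying his constraints. -/
def IsNashStat (φ : StatProfile G) : Prop :=
  (∀ i, Feas G i (ofStatAll G φ)) ∧
  ∀ (i : Fin n) (σ : Strategy G i), Feas G i (combine G (ofStatAll G φ) i σ) →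
    J G i 0 (ofStatAll G φ) ≤ J G i 0 (combine G (ofStatAll G φ) i σ)

section Occupation

/-- A correlated strategy of the players. -/
structure CorrStrategy where
  f : ∀ t, Hist X (JA A) t → ProbabilityMeasure (JA A)
  meas : ∀ t (s : Set (JA A)), MeasurableSet s →
    Measurable fun h => (f t h : Measure (JA A)) s
  supp : ∀ t h, f t h (jointSet G (lastState X (JA A) t h)) = 1

/-- History distributions under a correlated strategy. -/
noncomputable def histMeasC (π : CorrStrategy G) : ∀ t, Measure (Hist X (JA A) t)
  | 0 => G.η
  | t + 1 =>
      (histMeasC π t).bind fun h =>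
        ((π.f t h : Measure (JA A))).bind fun a =>
          (G.p (lastState X (JA A) t h) a).map fun y =>
            (show Hist X (JA A) (t + 1) from (h, a, y))

/-- The occupation measure `ρ(K') = (1-α) E^π_η [∑_{t≥1} α^{t-1} 1_{K'}(x^t,a^t)]`
of a correlated strategy, as a measure on the state–action pairs. -/
noncomputable def occ (π : CorrStrategy G) : Measure (X × JA A) :=
  ENNReal.ofReal (1 - G.α) •
    Measure.sum fun t : ℕ => ENNReal.ofReal G.α ^ t •
      ((histMeasC G π t).bind fun h =>
        (π.f t h : Measure (JA A)).map fun a => (lastState X (JA A) t h, a))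

/-- The set `𝓜` of occupation measures of correlated strategies. -/
def OccSet : Set (ProbabilityMeasure (X × JA A)) :=
  {ρ | ∃ π : CorrStrategy G, (ρ : Measure (X × JA A)) = occ G π}

/-- Projection of a state–action pair onto the coordinates of player `i`. -/
def projAct (i : Fin n) : X × JA A → X × A i := fun q => (q.1, q.2 i)

/-- The set `𝓜_i` of statewise projections of occupation measures onto `𝕂_i`. -/
def MiSet (i : Fin n) : Set (ProbabilityMeasure (X × A i)) :=
  {μ | ∃ ρ ∈ OccSet G, (μ : Measure (X × A i)) = (ρ : Measure (X × JA A)).map (projAct i)}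

/-- The marginal `μ̂(x) = μ({x} × A_i(x))`. -/
noncomputable def marg (i : Fin n) (μ : ProbabilityMeasure (X × A i)) (x : X) : ℝ≥0∞ :=
  (μ : Measure (X × A i)) ({x} ×ˢ G.As i x)

/-- `μ = μ̂ φ` : `φ` disintegrates `μ`, i.e. `μ({x} × B) = φ(B|x) μ̂(x)`. -/
def Disint (i : Fin n) (μ : ProbabilityMeasure (X × A i)) (φ : Stat G i) : Prop :=
  ∀ x (B : Set (A i)), MeasurableSet B → B ⊆ G.As i x →
    (μ : Measure (X × A i)) ({x} ×ˢ B) = (φ.1 x B : ℝ≥0∞) * marg G i μ x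

/-- The occupation measure on state–action pairs of a multi-strategy. -/
noncomputable def occMulti (η' : Measure X) (π : MultiStrategy G) : Measure (X × JA A) :=
  ENNReal.ofReal (1 - G.α) •
    Measure.sum fun t : ℕ => ENNReal.ofReal G.α ^ t •
      ((histMeas G η' π t).bind fun h =>
        (jointLaw G π t h).map fun a => (lastState X (JA A) t h, a))

end Occupation

section COP

/-- The product distribution on action profiles in state `x` in which player `i`
plays the fixed action `ai` and every player `j ≠ i` plays `φ j`. -/
noncomputable def statJoint (φ : StatProfile G) (i : Fin n) (x : X) (ai : A i) :
    Measure (JA A) :=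
  Measure.pi fun j =>
    if h : j = i then Measure.dirac (cast (congrArg A h.symm) ai)
    else ((φ j).1 x : Measure (A j))

/-- `c_i^ℓ(x, [φ_{-i}(x), a_i])`. -/
noncomputable def cbar (φ : StatProfile G) (i : Fin n) (ℓ : Fin (l + 1)) (x : X)
    (ai : A i) : ℝ :=
  ∫ a, G.c i ℓ x a ∂(statJoint G φ i x ai)

/-- `p(y | x, [φ_{-i}(x), a_i])`. -/
noncomputable def pbar (φ : StatProfile G) (i : Fin n) (y x : X) (ai : A i) : ℝ≥0∞ :=
  ∫⁻ a, G.p x a {y} ∂(statJoint G φ i x ai)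

/-- Feasibility in the constrained optimisation problem `COP(φ_{-i})`:
`μ ∈ Pr(𝕂_i)` satisfies the constraint inequalities and the characteristic
equations of occupation measures. -/
def COPFeasible (φ : StatProfile G) (i : Fin n)
    (μ : ProbabilityMeasure (X × A i)) : Prop :=
  (μ : Measure (X × A i)) {q : X × A i | q.2 ∈ G.As i q.1} = 1 ∧
  (∀ ℓ : Fin (l + 1), ℓ ≠ 0 →
    ∫ q : X × A i, cbar G φ i ℓ q.1 q.2 ∂(μ : Measure (X × A i)) ≤ G.κ i ℓ) ∧
  ∀ x : X, (μ : Measure (X × A i)) ({x} ×ˢ G.As i x) =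
    ENNReal.ofReal (1 - G.α) * G.η {x} +
      ENNReal.ofReal G.α *
        ∫⁻ q : X × A i, pbar G φ i x q.1 q.2 ∂(μ : Measure (X × A i))

/-- The objective of `COP(φ_{-i})`. -/
noncomputable def COPObj (φ : StatProfile G) (i : Fin n)
    (μ : ProbabilityMeasure (X × A i)) : ℝ :=
  ∫ q : X × A i, cbar G φ i 0 q.1 q.2 ∂(μ : Measure (X × A i))

/-- The solution set `𝓞_i(φ_{-i})` of `COP(φ_{-i})`. -/
def COPSol (φ : StatProfile G) (i : Fin n) : Set (ProbabilityMeasure (X × A i)) :=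
  {μ | COPFeasible G φ i μ ∧
    ∀ ν, COPFeasible G φ i ν → COPObj G φ i μ ≤ COPObj G φ i ν}

end COP

section Perturbed

/-- `η̃` is a probability measure charging exactly the `η`-null states `X_0`. -/
def IsPerturb (ηt : Measure X) : Prop :=
  IsProbabilityMeasure ηt ∧ (∀ x, G.η {x} = 0 → 0 < ηt {x}) ∧
    ∀ x, G.η {x} ≠ 0 → ηt {x} = 0

/-- The perturbed initial distribution `η(m) = (1 - 1/m) η + (1/m) η̃`. -/
noncomputable def etam (ηt : Measure X) (m : ℕ) : Measure X :=
  ENNReal.ofReal (1 - 1 / (m : ℝ)) • G.η + ENNReal.ofReal (1 / (m : ℝ)) • ηt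

/-- The truncation `c_i^{ℓ,m}` of `c_i^ℓ` at the level `√m`. -/
noncomputable def ctrunc (i : Fin n) (ℓ : Fin (l + 1)) (m : ℕ) (x : X) (a : JA A) : ℝ :=
  max (-Real.sqrt m) (min (G.c i ℓ x a) (Real.sqrt m))

/-- `J_i^{ℓ,η(m)}`: discounted cost with truncated costs and perturbed initial
distribution. -/
noncomputable def Jm (ηt : Measure X) (m : ℕ) (i : Fin n) (ℓ : Fin (l + 1))
    (π : MultiStrategy G) : ℝ :=
  Jfun G (etam G ηt m) (ctrunc G i ℓ m) π

/-- The perturbed constraint bounds `κ_i^{ℓ,m} = (1 - 1/m) κ_i^ℓ + 1/√m`. -/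
noncomputable def kappam (i : Fin n) (ℓ : Fin (l + 1)) (m : ℕ) : ℝ :=
  (1 - 1 / (m : ℝ)) * G.κ i ℓ + 1 / Real.sqrt m

/-- `π_i ∈ Δ_i^m(π_{-i})` : the constraints of the `m`-CSG hold. -/
def FeasM (ηt : Measure X) (m : ℕ) (i : Fin n) (π : MultiStrategy G) : Prop :=
  ∀ ℓ : Fin (l + 1), ℓ ≠ 0 → Jm G ηt m i ℓ π ≤ kappam G i ℓ m

end Perturbed

end CSGame

namespace CSGame
namespace Scarf

variable {V I : Type} [Fintype V] [DecidableEq V] [Fintype I] [DecidableEq I]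

def Dom (u : I → V → ℤ) (σ : Finset V) : Prop := ∀ y, ∃ i, ∀ x ∈ σ, u i y ≤ u i x

theorem Dom.mono {u : I → V → ℤ} {σ τ : Finset V} (h : Dom u σ) (hs : τ ⊆ σ) : Dom u τ :=
  fun y => (h y).imp fun _ hi x hx => hi x (hs hx)

/-- maximal elements of the set `M_i`. -/
def PM (u : I → V → ℤ) (mn : I → V) (i : I) (x : V) : Prop :=
  (∀ j, j ≠ i → u j (mn j) < u j x) ∧
    ∀ y, (∀ j, j ≠ i → u j (mn j) < u j y) → u i y ≤ u i x

theorem exists_mins {u : I → V → ℤ} {τ : Finset V} (hne : τ.Nonempty) :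
    ∃ mn : I → V, ∀ i, mn i ∈ τ ∧ ∀ x ∈ τ, u i (mn i) ≤ u i x := by
  choose mn h1 h2 using fun i => Finset.exists_min_image τ (u i) hne
  exact ⟨mn, fun i => ⟨h1 i, h2 i⟩⟩

theorem PM_exists (u : I → V → ℤ) (mn : I → V) (i : I) (x0 : V)
    (hx0 : ∀ j, j ≠ i → u j (mn j) < u j x0) : ∃ x, PM u mn i x := by
  classical
  obtain ⟨x, hx, hm⟩ := Finset.exists_max_image
    (Finset.univ.filter fun x => ∀ j, j ≠ i → u j (mn j) < u j x) (u i) ⟨x0, by simpa using hx0⟩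
  exact ⟨x, by simpa using hx, fun y hy => hm y (by simpa using hy)⟩

theorem PM_unique {u : I → V → ℤ} (hu : ∀ i, Function.Injective (u i)) {mn : I → V} {i : I}
    {x y : V} (hx : PM u mn i x) (hy : PM u mn i y) : x = y :=
  hu i (le_antisymm (hy.2 _ hx.1) (hx.2 _ hy.1))

/-- structure of the rooms over a door -/
theorem door_struct {u : I → V → ℤ} (hu : ∀ i, Function.Injective (u i)) {τ : Finset V}
    (hcard : τ.card + 1 = Fintype.card I) (hd : Dom u τ) {mn : I → V}
    (hmn : ∀ i, mn i ∈ τ ∧ ∀ x ∈ τ, u i (mn i) ≤ u i x) :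
    ∃ a b, a ≠ b ∧ mn a = mn b ∧
      (∀ x, (x ∉ τ ∧ Dom u (insert x τ)) ↔ (PM u mn a x ∨ PM u mn b x)) ∧
      (∀ x, ¬ (PM u mn a x ∧ PM u mn b x)) := by
  have hsurj : ∀ x ∈ τ, ∃ i, mn i = x := by
    intro x hx
    obtain ⟨i, hi⟩ := hd x
    exact ⟨i, hu i (le_antisymm ((hmn i).2 x hx) (hi _ (hmn i).1))⟩
  have hex : ∃ a b, a ≠ b ∧ mn a = mn b := by
    by_contra hcon
    push Not at hcon
    have hinj : Function.Injective mn := by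
      intro a b hab
      by_contra hne
      exact hcon a b hne hab
    have : (Finset.univ.image mn).card ≤ τ.card :=
      Finset.card_le_card (by intro x hx; simp at hx; obtain ⟨i, rfl⟩ := hx; exact (hmn i).1)
    rw [Finset.card_image_of_injective _ hinj, Finset.card_univ] at this
    omega
  obtain ⟨a, b, hab, hmab⟩ := hex
  -- every element of τ is `mn j` with `j ≠ i`, for `i ∈ {a,b}`
  have hsa : ∀ i, (i = a ∨ i = b) → ∀ x ∈ τ, ∃ j, j ≠ i ∧ mn j = x := by
    intro i hi x hx
    obtain ⟨j, hj⟩ := hsurj x hx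
    by_cases hji : j = i
    · rcases hi with rfl | rfl
      · exact ⟨b, hab.symm, by rw [← hmab, ← hj, hji]⟩
      · exact ⟨a, hab, by rw [hmab, ← hj, hji]⟩
    · exact ⟨j, hji, hj⟩
  refine ⟨a, b, hab, hmab, ?_, ?_⟩
  · intro x
    constructor
    · rintro ⟨hx, hdx⟩
      obtain ⟨i, hi⟩ := hdx x
      -- minima of the room
      obtain ⟨mn', hmn'⟩ := exists_mins (u := u) (τ := insert x τ) ⟨x, by simp⟩
      have hsurj' : ∀ z ∈ insert x τ, ∃ i, mn' i = z := by
        intro z hz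
        obtain ⟨i, hi⟩ := hdx z
        exact ⟨i, hu i (le_antisymm ((hmn' i).2 z hz) (hi _ (hmn' i).1))⟩
      have hbij : Set.InjOn mn' (Finset.univ : Finset I) := by
        apply Finset.card_image_iff.mp
        have h1 : Finset.univ.image mn' = insert x τ := by
          ext z
          constructor
          · intro hz; simp only [Finset.mem_image, Finset.mem_univ, true_and] at hz
            obtain ⟨i, rfl⟩ := hz; exact (hmn' i).1
          · intro hz; obtain ⟨i, rfl⟩ := hsurj' z hz; simp
        rw [h1, Finset.card_insert_of_notMem hx, hcard, Finset.card_univ]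
      have hix : mn' i = x := hu i (le_antisymm ((hmn' i).2 x (by simp)) (hi _ (hmn' i).1))
      have hj : ∀ j, j ≠ i → mn' j = mn j := by
        intro j hji
        have h1 : mn' j ≠ x := by
          intro h; exact hji (hbij (by simp) (by simp) (h.trans hix.symm))
        have h2 : mn' j ∈ τ := by
          have := (hmn' j).1
          simp only [Finset.mem_insert] at this
          exact this.resolve_left h1
        exact hu j (le_antisymm ((hmn' j).2 _ (by simp [(hmn j).1])) ((hmn j).2 _ h2))
      have hiab : i = a ∨ i = b := by
        by_contra hcon
        push Not at hcon
        have h1 := hj a hcon.1.symm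
        have h2 := hj b hcon.2.symm
        exact hab (hbij (by simp) (by simp) (by rw [h1, h2, hmab]))
      have hPM : PM u mn i x := by
        constructor
        · intro j hji
          have h1 := (hmn' j).2 x (by simp)
          rw [hj j hji] at h1
          refine lt_of_le_of_ne h1 fun h => ?_
          exact hx (hu j h ▸ (hmn j).1)
        · intro y hy
          obtain ⟨k, hk⟩ := hdx y
          by_cases hki : k = i
          · subst hki; exact hk x (by simp)
          · exact absurd (hk (mn k) (by simp [(hmn k).1])) (not_le.mpr (hy k hki))
      rcases hiab with rfl | rfl
      · exact Or.inl hPM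
      · exact Or.inr hPM
    · intro h
      have : ∃ i, (i = a ∨ i = b) ∧ PM u mn i x := by
        rcases h with h | h
        · exact ⟨a, Or.inl rfl, h⟩
        · exact ⟨b, Or.inr rfl, h⟩
      obtain ⟨i, hi, hP⟩ := this
      constructor
      · intro hx
        obtain ⟨j, hji, hj⟩ := hsa i hi x hx
        have := hP.1 j hji
        rw [hj] at this
        exact lt_irrefl _ this
      · intro y
        by_cases hy : ∀ j, j ≠ i → u j (mn j) < u j y
        · refine ⟨i, fun z hz => ?_⟩
          rcases Finset.mem_insert.mp hz with rfl | hz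
          · exact hP.2 y hy
          · obtain ⟨k, hk⟩ := hd y
            by_cases hki : k = i
            · subst hki; exact hk z hz
            · exact absurd (hk (mn k) (hmn k).1) (not_le.mpr (hy k hki))
        · push Not at hy
          obtain ⟨j, hji, hj⟩ := hy
          refine ⟨j, fun z hz => ?_⟩
          rcases Finset.mem_insert.mp hz with rfl | hz
          · exact hj.trans (hP.1 j hji).le
          · exact hj.trans ((hmn j).2 z hz)
  · rintro x ⟨h1, h2⟩
    obtain ⟨k, hk⟩ := hd x
    have := hk (mn k) (hmn k).1
    by_cases hka : k = a
    · exact absurd this (not_le.mpr (h2.1 k (by rw [hka]; exact hab)))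
    · exact absurd this (not_le.mpr (h1.1 k hka))

open Classical in
theorem rooms_over (u : I → V → ℤ) {τ : Finset V} {m : ℕ} (hcard : τ.card + 1 = m) :
    (Finset.univ.filter fun σ : Finset V => (σ.card = m ∧ Dom u σ) ∧ τ ⊆ σ).card =
    (Finset.univ.filter fun x : V => x ∉ τ ∧ Dom u (insert x τ)).card := by
  symm
  refine Finset.card_bij (fun x _ => insert x τ) ?_ ?_ ?_
  · intro x hx
    simp only [Finset.mem_filter, Finset.mem_univ, true_and] at hx ⊢
    exact ⟨⟨by rw [Finset.card_insert_of_notMem hx.1, hcard], hx.2⟩, Finset.subset_insert _ _⟩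
  · intro x hx y hy hxy
    simp only [Finset.mem_filter, Finset.mem_univ, true_and] at hx hy
    have : x ∈ insert y τ := hxy ▸ Finset.mem_insert_self x τ
    exact (Finset.mem_insert.mp this).resolve_right hx.1
  · intro σ hσ
    simp only [Finset.mem_filter, Finset.mem_univ, true_and] at hσ
    have h1 : (σ \ τ).card = 1 := by
      rw [Finset.card_sdiff_of_subset hσ.2]; omega
    obtain ⟨x, hx⟩ := Finset.card_eq_one.mp h1
    have hx' : insert x τ = σ := by
      rw [Finset.insert_eq, ← hx, Finset.sdiff_union_of_subset hσ.2]
    have hxτ : x ∉ τ := by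
      have : x ∈ σ \ τ := by rw [hx]; simp
      exact (Finset.mem_sdiff.mp this).2
    exact ⟨x, by simp only [Finset.mem_filter, Finset.mem_univ, true_and, hx']; exact ⟨hxτ, hσ.1.2⟩, hx'⟩

open Classical in
theorem room_doors (c : V → I) (i0 : I) {σ : Finset V} (hcard : σ.card = Fintype.card I)
    (hnc : σ.image c ≠ Finset.univ) :
    Even (Finset.univ.filter fun τ : Finset V =>
      (τ.card + 1 = Fintype.card I ∧ τ.image c = Finset.univ.erase i0) ∧ τ ⊆ σ).card := by
  by_cases hex : ∃ τ : Finset V,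
      (τ.card + 1 = Fintype.card I ∧ τ.image c = Finset.univ.erase i0) ∧ τ ⊆ σ
  swap
  · rw [Finset.filter_false_of_mem]
    · simp
    · intro τ _ h; exact hex ⟨τ, h⟩
  obtain ⟨τ, ⟨hτc, hτi⟩, hτσ⟩ := hex
  have hinj : Set.InjOn c τ := by
    apply Finset.card_image_iff.mp
    rw [hτi, Finset.card_erase_of_mem (Finset.mem_univ _), Finset.card_univ]; omega
  have h1 : (σ \ τ).card = 1 := by
    rw [Finset.card_sdiff_of_subset hτσ]; omega
  obtain ⟨x, hx⟩ := Finset.card_eq_one.mp h1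
  have hσ : insert x τ = σ := by
    rw [Finset.insert_eq, ← hx, Finset.sdiff_union_of_subset hτσ]
  have hxτ : x ∉ τ := by
    have : x ∈ σ \ τ := by rw [hx]; simp
    exact (Finset.mem_sdiff.mp this).2
  have hcx : c x ≠ i0 := by
    intro h
    apply hnc
    rw [← hσ, Finset.image_insert, hτi, h, Finset.insert_erase (Finset.mem_univ _)]
  have : c x ∈ τ.image c := by rw [hτi]; simp [hcx]
  obtain ⟨x', hx'τ, hx'⟩ := Finset.mem_image.mp this
  have hne : x ≠ x' := fun h => hxτ (h ▸ hx'τ)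
  have himg : σ.image c = Finset.univ.erase i0 := by
    rw [← hσ, Finset.image_insert, hτi]
    exact Finset.insert_eq_of_mem (by simp [hcx])
  have key : (Finset.univ.filter fun τ : Finset V =>
      (τ.card + 1 = Fintype.card I ∧ τ.image c = Finset.univ.erase i0) ∧ τ ⊆ σ)
      = {τ, insert x (τ.erase x')} := by
    ext ρ
    simp only [Finset.mem_filter, Finset.mem_univ, true_and, Finset.mem_insert,
      Finset.mem_singleton]
    constructor
    · rintro ⟨⟨hρc, hρi⟩, hρσ⟩
      have hinjρ : Set.InjOn c ρ := by
        apply Finset.card_image_iff.mp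
        rw [hρi, Finset.card_erase_of_mem (Finset.mem_univ _), Finset.card_univ]; omega
      by_cases hxρ : x ∈ ρ
      · right
        have hx'ρ : x' ∉ ρ := fun h => hne (hinjρ hxρ h hx'.symm)
        apply Finset.eq_of_subset_of_card_le
        · intro z hz
          have hzσ := hρσ hz
          rw [← hσ] at hzσ
          rcases Finset.mem_insert.mp hzσ with rfl | hzτ
          · simp
          · exact Finset.mem_insert_of_mem (Finset.mem_erase.mpr ⟨fun h => hx'ρ (h ▸ hz), hzτ⟩)
        · have := Finset.card_insert_le x (τ.erase x')
          have := Finset.card_erase_of_mem hx'τ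
          have := Finset.card_pos.mpr ⟨x', hx'τ⟩
          omega
      · left
        apply Finset.eq_of_subset_of_card_le
        · intro z hz
          have hzσ := hρσ hz
          rw [← hσ] at hzσ
          rcases Finset.mem_insert.mp hzσ with rfl | hzτ
          · exact absurd hz hxρ
          · exact hzτ
        · omega
    · rintro (rfl | rfl)
      · exact ⟨⟨hτc, hτi⟩, hτσ⟩
      · have hxe : x ∉ τ.erase x' := fun h => hxτ (Finset.mem_of_mem_erase h)
        have hpos := Finset.card_pos.mpr ⟨x', hx'τ⟩
        refine ⟨⟨?_, ?_⟩, ?_⟩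
        · rw [Finset.card_insert_of_notMem hxe, Finset.card_erase_of_mem hx'τ]; omega
        · rw [← hτi]
          ext k
          simp only [Finset.mem_image, Finset.mem_insert, Finset.mem_erase]
          constructor
          · rintro ⟨z, rfl | hz, rfl⟩
            · exact ⟨x', hx'τ, hx'⟩
            · exact ⟨z, hz.2, rfl⟩
          · rintro ⟨z, hz, rfl⟩
            by_cases hzx : z = x'
            · exact ⟨x, Or.inl rfl, by rw [hzx, hx']⟩
            · exact ⟨z, Or.inr ⟨hzx, hz⟩, rfl⟩
        · rw [← hσ]
          exact Finset.insert_subset_insert _ (Finset.erase_subset _ _)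
  rw [key, Finset.card_pair]
  · exact even_two
  · intro h
    exact hxτ (h ▸ Finset.mem_insert_self x _)

open Classical in
theorem scarf (s : I → V) (hs : Function.Injective s) (u : I → V → ℤ)
    (hu : ∀ i, Function.Injective (u i))
    (hmin : ∀ i v, v ≠ s i → u i (s i) < u i v)
    (htop : ∀ i k v, k ≠ i → (∀ j, v ≠ s j) → u i v < u i (s k))
    (c : V → I) (hc : ∀ i, c (s i) = i) (i0 : I) :
    ∃ σ : Finset V, Dom u σ ∧ ∀ i, ∃ x ∈ σ, c x = i := by
  by_cases hone : Fintype.card I ≤ 1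
  · have hsub := Fintype.card_le_one_iff_subsingleton.mp hone
    obtain ⟨v, -, hv⟩ := Finset.exists_max_image Finset.univ (u i0) ⟨s i0, Finset.mem_univ _⟩
    refine ⟨{v}, fun y => ⟨i0, fun x hx => ?_⟩, fun i => ⟨v, by simp, Subsingleton.elim _ _⟩⟩
    rw [Finset.mem_singleton.mp hx]; exact hv y (Finset.mem_univ _)
  by_contra hcon
  set R : Finset (Finset V) :=
    Finset.univ.filter fun σ : Finset V => (σ.card = Fintype.card I ∧ Dom u σ) with hR
  set D : Finset (Finset V) := Finset.univ.filter fun τ : Finset V =>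
      (τ.card + 1 = Fintype.card I ∧ τ.image c = Finset.univ.erase i0) with hD
  have hcount := Finset.sum_card_bipartiteAbove_eq_sum_card_bipartiteBelow
    (s := R) (t := D) (fun σ τ => τ ⊆ σ)
  have hL : Even (∑ σ ∈ R, (D.bipartiteAbove (fun σ τ => τ ⊆ σ) σ).card) := by
    apply Finset.even_sum
    intro σ hσ
    simp only [hR, Finset.mem_filter, Finset.mem_univ, true_and] at hσ
    have := room_doors c i0 hσ.1 (by
      intro h
      apply hcon
      refine ⟨σ, hσ.2, fun i => ?_⟩
      have : i ∈ σ.image c := by rw [h]; simp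
      simpa using this)
    simpa only [Finset.bipartiteAbove, hD, Finset.filter_filter] using this
  set τ0 : Finset V := (Finset.univ.erase i0).image s with hτ0
  have hτ0card : τ0.card + 1 = Fintype.card I := by
    rw [hτ0, Finset.card_image_of_injective _ hs, Finset.card_erase_of_mem (Finset.mem_univ _),
      Finset.card_univ]; omega
  have hτ0D : τ0 ∈ D := by
    simp only [hD, Finset.mem_filter, Finset.mem_univ, true_and]
    refine ⟨hτ0card, ?_⟩
    rw [hτ0, Finset.image_image]
    have : c ∘ s = id := funext hc
    rw [this, Finset.image_id]
  have hB : ∀ τ ∈ D, (R.bipartiteBelow (fun σ τ => τ ⊆ σ) τ).card =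
      (Finset.univ.filter fun x : V => x ∉ τ ∧ Dom u (insert x τ)).card := by
    intro τ hτ
    simp only [hD, Finset.mem_filter, Finset.mem_univ, true_and] at hτ
    rw [← rooms_over u hτ.1]
    simp only [Finset.bipartiteBelow, hR, Finset.filter_filter]
  have hcard1 : ∀ (mn : I → V) (i : I) (x : V), PM u mn i x →
      (Finset.univ.filter fun x : V => PM u mn i x).card = 1 := by
    intro mn i x hx
    rw [Finset.card_eq_one]
    refine ⟨x, ?_⟩
    ext y
    simp only [Finset.mem_filter, Finset.mem_univ, true_and, Finset.mem_singleton]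
    exact ⟨fun h => PM_unique hu h hx, fun h => h ▸ hx⟩
  have hE : ∀ τ ∈ D, τ ≠ τ0 →
      Even (Finset.univ.filter fun x : V => x ∉ τ ∧ Dom u (insert x τ)).card := by
    intro τ hτ hne
    simp only [hD, Finset.mem_filter, Finset.mem_univ, true_and] at hτ
    by_cases hdom : Dom u τ
    swap
    · rw [Finset.filter_false_of_mem]
      · simp
      · intro x _ h; exact hdom (h.2.mono (Finset.subset_insert _ _))
    have hw : ∃ w ∈ τ, ∀ j, w ≠ s j := by
      by_contra hno
      push Not at hno
      apply hne
      apply Finset.eq_of_subset_of_card_le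
      · intro w hw
        obtain ⟨j, rfl⟩ := hno w hw
        refine Finset.mem_image_of_mem s ?_
        have : c (s j) ∈ τ.image c := Finset.mem_image_of_mem c hw
        rw [hτ.2, hc] at this
        exact this
      · omega
    obtain ⟨w, hwτ, hw⟩ := hw
    obtain ⟨mn, hmn⟩ := exists_mins (u := u) (τ := τ) ⟨w, hwτ⟩
    obtain ⟨a, b, hab, hmab, hiff, hdis⟩ := door_struct hu hτ.1 hdom hmn
    have hMi : ∀ i, ∃ x, PM u mn i x := fun i => PM_exists u mn i (s i) fun j hj =>
      ((hmn j).2 w hwτ).trans_lt (htop j i w hj.symm hw)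
    obtain ⟨xa, hxa⟩ := hMi a
    obtain ⟨xb, hxb⟩ := hMi b
    simp_rw [hiff]
    rw [Finset.filter_or, Finset.card_union_of_disjoint, hcard1 mn a xa hxa, hcard1 mn b xb hxb]
    · exact even_two
    · rw [Finset.disjoint_filter]
      intro x _ h1 h2; exact hdis x ⟨h1, h2⟩
  have hO : (Finset.univ.filter fun x : V => x ∉ τ0 ∧ Dom u (insert x τ0)).card = 1 := by
    have hne : τ0.Nonempty := by
      rw [← Finset.card_pos]; omega
    have hmem : ∀ j, j ≠ i0 → s j ∈ τ0 := fun j hj => Finset.mem_image_of_mem s (by simp [hj])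
    have hdom : Dom u τ0 := by
      intro y
      by_cases hy : ∃ j, y = s j
      · obtain ⟨j, rfl⟩ := hy
        refine ⟨j, fun x _ => ?_⟩
        by_cases hx : x = s j
        · rw [hx]
        · exact (hmin j x hx).le
      · push Not at hy
        refine ⟨i0, fun x hx => ?_⟩
        obtain ⟨k, hk, rfl⟩ := Finset.mem_image.mp hx
        exact (htop i0 k y (Finset.ne_of_mem_erase hk) hy).le
    obtain ⟨mn, hmn⟩ := exists_mins (u := u) (τ := τ0) hne
    have hmns : ∀ j, j ≠ i0 → mn j = s j := by
      intro j hj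
      by_contra h
      exact absurd ((hmn j).2 (s j) (hmem j hj)) (not_le.mpr (hmin j _ h))
    obtain ⟨a, b, hab, hmab, hiff, hdis⟩ := door_struct hu hτ0card hdom hmn
    obtain ⟨x0, hx0⟩ : ∃ x, PM u mn i0 x := PM_exists u mn i0 (s i0) fun j hj => by
      rw [hmns j hj]; exact hmin j _ (fun h => hj (hs h).symm)
    have hno : ∀ b, b ≠ i0 → mn i0 = mn b → ∀ x, ¬ PM u mn b x := by
      intro b hb hmb x hx
      have h1 := hx.1 i0 hb.symm
      rw [hmb, hmns b hb] at h1
      by_cases hxs : ∃ k, x = s k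
      · obtain ⟨k, rfl⟩ := hxs
        by_cases hkb : k = b
        · subst hkb; exact lt_irrefl _ h1
        by_cases hki : k = i0
        · subst hki
          exact absurd (hmin k (s b) (fun h => hb (hs h))) (not_lt.mpr h1.le)
        · have := hx.1 k hkb
          rw [hmns k hki] at this
          exact lt_irrefl _ this
      · push Not at hxs
        exact absurd (htop i0 b x hb hxs) (not_lt.mpr h1.le)
    rw [← hcard1 mn i0 x0 hx0]
    congr 1
    ext x
    simp only [Finset.mem_filter, Finset.mem_univ, true_and, hiff]
    by_cases ha : a = i0
    · subst ha
      have := hno b hab.symm hmab x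
      tauto
    · by_cases hb : b = i0
      · subst hb
        have := hno a hab hmab.symm x
        tauto
      · exfalso
        rw [hmns a ha, hmns b hb] at hmab
        exact hab (hs hmab)
  have hRodd : Odd (∑ τ ∈ D, (R.bipartiteBelow (fun σ τ => τ ⊆ σ) τ).card) := by
    rw [← Finset.add_sum_erase _ _ hτ0D, hB τ0 hτ0D, hO]
    rw [add_comm]
    apply Even.add_one
    apply Finset.even_sum
    intro τ hτ
    rw [hB τ (Finset.mem_of_mem_erase hτ)]
    exact hE τ (Finset.mem_of_mem_erase hτ) (Finset.ne_of_mem_erase hτ)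
  rw [← hcount] at hRodd
  exact (Nat.not_even_iff_odd.mpr hRodd) hL

end Scarf
end CSGame


namespace CSGame
namespace Scarf

/-- Grid points of the simplex. -/
abbrev Grid (I : Type) [Fintype I] (N : ℕ) : Type := {x : I → Fin (N + 1) // ∑ i, (x i : ℕ) = N}

theorem grid_lemma {I : Type} [Fintype I] [DecidableEq I] [Nonempty I] (N : ℕ)
    (c : Grid I N → I) :
    ∃ x0 : Grid I N, ∀ i, ∃ x : Grid I N,
      (∀ j, (x.1 j : ℕ) ≤ x0.1 j + Fintype.card I ∧ (x0.1 j : ℕ) ≤ x.1 j + Fintype.card I) ∧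
      (c x = i ∨ (x.1 i : ℕ) ≤ Fintype.card I) := by
  classical
  set K := Fintype.card (Grid I N) with hK
  let e : Grid I N ≃ Fin K := Fintype.equivFin _
  let e' : I ≃ Fin (Fintype.card I) := Fintype.equivFin _
  let u : I → (Grid I N ⊕ I) → ℤ := fun i v => match v with
    | Sum.inl x => ((x.1 i : ℕ) : ℤ) * K + (e x : ℕ)
    | Sum.inr k => if k = i then -1 else ((N : ℤ) + 1) * K + (e' k : ℕ)
  have ul : ∀ i x, u i (Sum.inl x) = ((x.1 i : ℕ) : ℤ) * K + (e x : ℕ) := fun _ _ => rfl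
  have ur : ∀ i k, u i (Sum.inr k) = if k = i then -1 else ((N : ℤ) + 1) * K + (e' k : ℕ) :=
    fun _ _ => rfl
  have hlt : ∀ i x, u i (Sum.inl x) < ((N : ℤ) + 1) * K := by
    intro i x
    rw [ul]
    have h1 : ((x.1 i : ℕ) : ℤ) ≤ N := by have := (x.1 i).2; omega
    have h2 : ((e x : ℕ) : ℤ) < K := by exact_mod_cast (e x).2
    nlinarith
  have hge : ∀ i x, 0 ≤ u i (Sum.inl x) := by
    intro i x; rw [ul]; positivity
  have hrg : ∀ i k, k ≠ i → ((N : ℤ) + 1) * K ≤ u i (Sum.inr k) := by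
    intro i k hk; rw [ur, if_neg hk]; have : (0 : ℤ) ≤ (e' k : ℕ) := by positivity
    omega
  have hcmp : ∀ i (x y : Grid I N), u i (Sum.inl x) ≤ u i (Sum.inl y) →
      (x.1 i : ℕ) ≤ y.1 i := by
    intro i x y h
    rw [ul, ul] at h
    by_contra hcon
    push Not at hcon
    have h2 : ((e y : ℕ) : ℤ) < K := by exact_mod_cast (e y).2
    have h3 : (0 : ℤ) ≤ (e x : ℕ) := by positivity
    have h4 : ((y.1 i : ℕ) : ℤ) + 1 ≤ ((x.1 i : ℕ) : ℤ) := by exact_mod_cast hcon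
    have h5 : (0 : ℤ) ≤ K := by positivity
    nlinarith
  have hu : ∀ i, Function.Injective (u i) := by
    intro i v w h
    rcases v with x | k <;> rcases w with y | k'
    · have h1 := le_antisymm (hcmp i x y h.le) (hcmp i y x h.ge)
      rw [ul, ul, h1] at h
      have : ((e x : ℕ) : ℤ) = (e y : ℕ) := by linarith
      have : e x = e y := Fin.ext (by exact_mod_cast this)
      rw [e.injective this]
    · exfalso
      by_cases hk : k' = i
      · have := hge i x; rw [h, ur, if_pos hk] at this; omega
      · have h1 := hlt i x; have h2 := hrg i k' hk; omega
    · exfalso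
      by_cases hk : k = i
      · have := hge i y; rw [← h, ur, if_pos hk] at this; omega
      · have h1 := hlt i y; have h2 := hrg i k hk; omega
    · have hpos : (0 : ℤ) ≤ ((N : ℤ) + 1) * K := by positivity
      by_cases hk : k = i <;> by_cases hk' : k' = i
      · rw [hk, hk']
      · have h2 := hrg i k' hk'; rw [← h, ur, if_pos hk] at h2; omega
      · have h2 := hrg i k hk; rw [h, ur, if_pos hk'] at h2; omega
      · rw [ur, ur, if_neg hk, if_neg hk'] at h
        have : ((e' k : ℕ) : ℤ) = (e' k' : ℕ) := by linarith
        have : e' k = e' k' := Fin.ext (by exact_mod_cast this)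
        rw [e'.injective this]
  have hpos : (0 : ℤ) ≤ ((N : ℤ) + 1) * K := by positivity
  obtain ⟨σ, hdom, hcol⟩ := scarf (Sum.inr : I → Grid I N ⊕ I) Sum.inr_injective u hu
    (by
      intro i v hv
      rw [ur, if_pos rfl]
      rcases v with x | k
      · have := hge i x; omega
      · have hk : k ≠ i := fun h => hv (by rw [h])
        have := hrg i k hk; omega)
    (by
      intro i k v hk hv
      rcases v with x | k'
      · exact (hlt i x).trans_le (hrg i k hk)
      · exact absurd rfl (hv k'))
    (Sum.elim c id) (fun i => rfl) (Classical.arbitrary I)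
  have hin : ∀ i, Sum.inr i ∈ σ → ∀ y : Grid I N, ¬ ∀ x ∈ σ, u i (Sum.inl y) ≤ u i x := by
    intro i hi y h
    have h1 := h _ hi
    rw [ur, if_pos rfl] at h1
    have := hge i y; omega
  let i1 : I := Classical.arbitrary I
  let y0 : Grid I N := ⟨fun i => if i = i1 then Fin.last N else 0, by
    rw [Finset.sum_eq_single i1]
    · simp
    · intro b _ hb; simp [hb]
    · simp⟩
  obtain ⟨x0, hx0⟩ : ∃ x0 : Grid I N, Sum.inl x0 ∈ σ := by
    obtain ⟨i, hi⟩ := hdom (Sum.inl y0)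
    obtain ⟨x, hx, hcx⟩ := hcol i
    rcases x with x | k
    · exact ⟨x, hx⟩
    · have : k = i := hcx
      subst this
      exact absurd hi (hin k hx y0)
  -- coordinate minima
  have hmins := fun i => Finset.exists_min_image
    (Finset.univ.filter fun x : Grid I N => Sum.inl x ∈ σ) (fun x => (x.1 i : ℕ))
    ⟨x0, by simpa using hx0⟩
  choose xm hxm1 hxm2 using hmins
  simp only [Finset.mem_filter, Finset.mem_univ, true_and] at hxm1 hxm2
  set m : I → ℕ := fun i => ((xm i).1 i : ℕ) with hm
  set C : Finset I := Finset.univ.filter fun i => Sum.inr i ∉ σ with hC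
  have hbig : N < ∑ i ∈ C, (m i + 1) := by
    by_contra hcon
    push Not at hcon
    set S := ∑ i ∈ C, (m i + 1) with hS
    let yv : I → ℕ := fun i => (if i ∈ C then m i + 1 else 0) + (if i = i1 then N - S else 0)
    have hsum : ∑ i, yv i = N := by
      simp only [yv, Finset.sum_add_distrib]
      rw [Finset.sum_ite_mem, Finset.univ_inter, Finset.sum_ite_eq' Finset.univ i1]
      simp only [Finset.mem_univ, if_true]
      omega
    have hle : ∀ i, yv i < N + 1 := by
      intro i
      have := Finset.single_le_sum (f := yv) (fun _ _ => Nat.zero_le _) (Finset.mem_univ i)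
      omega
    let y : Grid I N := ⟨fun i => ⟨yv i, hle i⟩, hsum⟩
    obtain ⟨i, hi⟩ := hdom (Sum.inl y)
    have hiC : i ∈ C := by
      simp only [hC, Finset.mem_filter, Finset.mem_univ, true_and]
      intro h
      exact hin i h y hi
    have h1 := hcmp i y (xm i) (hi _ (hxm1 i))
    have h2 : ((y.1 i : ℕ)) = yv i := rfl
    have h3 : m i + 1 ≤ yv i := by simp only [yv, if_pos hiC]; omega
    have h4 : m i = ((xm i).1 i : ℕ) := rfl
    omega
  have hCc : C.card ≤ Fintype.card I := Finset.card_le_univ C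
  rw [Finset.sum_add_distrib, Finset.sum_const, smul_eq_mul, mul_one] at hbig
  have hxs : ∀ x : Grid I N, Sum.inl x ∈ σ → ∀ j,
      (j ∈ C → m j ≤ (x.1 j : ℕ) ∧ (x.1 j : ℕ) ≤ m j + Fintype.card I) ∧
      (j ∉ C → (x.1 j : ℕ) ≤ Fintype.card I) := by
    intro x hx j
    have hge' : ∀ i, m i ≤ (x.1 i : ℕ) := fun i => hxm2 i x hx
    have hxN := x.2
    have hCs : ∑ i ∈ C, (x.1 i : ℕ) + ∑ i ∈ Finset.univ \ C, (x.1 i : ℕ) = N := by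
      rw [add_comm, Finset.sum_sdiff (Finset.subset_univ C)]; exact hxN
    constructor
    · intro hj
      refine ⟨hge' j, ?_⟩
      have h1 : ∑ i ∈ C.erase j, m i ≤ ∑ i ∈ C.erase j, (x.1 i : ℕ) :=
        Finset.sum_le_sum fun i _ => hge' i
      have h2 := Finset.add_sum_erase C m hj
      have h3 := Finset.add_sum_erase C (fun i => (x.1 i : ℕ)) hj
      omega
    · intro hj
      have h1 : ∑ i ∈ C, m i ≤ ∑ i ∈ C, (x.1 i : ℕ) :=
        Finset.sum_le_sum fun i _ => hge' i
      have h2 := Finset.single_le_sum (f := fun i => (x.1 i : ℕ)) (fun _ _ => Nat.zero_le _)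
        (show j ∈ Finset.univ \ C by simp [hj])
      omega
  refine ⟨x0, fun i => ?_⟩
  obtain ⟨x, hx, hcx⟩ := hcol i
  rcases x with x | k
  · refine ⟨x, fun j => ?_, Or.inl hcx⟩
    have h1 := hxs x hx j
    have h2 := hxs x0 hx0 j
    by_cases hj : j ∈ C
    · have := h1.1 hj; have := h2.1 hj; omega
    · have := h1.2 hj; have := h2.2 hj; omega
  · have hk : k = i := hcx
    subst hk
    refine ⟨x0, fun j => by omega, Or.inr ?_⟩
    exact (hxs x0 hx0 k).2 (by simp [hC, hx])

/-- Finite-dimensional Ky Fan / KKM lemma on the simplex. -/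
theorem simplex_kyfan {I : Type} [Fintype I] [Nonempty I] (f : I → (I → ℝ) → ℝ)
    (hf : ∀ i, ContinuousOn (f i) (stdSimplex ℝ I))
    (h : ∀ t ∈ stdSimplex ℝ I, ∑ i, t i * f i t ≤ 0) :
    ∃ t ∈ stdSimplex ℝ I, ∀ i, f i t ≤ 0 := by
  classical
  set g : I → (I → ℝ) → ℝ := fun i t => max (f i t) 0 with hg
  set F : (I → ℝ) → ℝ := fun t => ∑ i, g i t with hF
  set H : I → (I → ℝ) → ℝ := fun i t => t i * F t - g i t with hH
  have hgc : ∀ i, ContinuousOn (g i) (stdSimplex ℝ I) := fun i => (hf i).sup continuousOn_const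
  have hFc : ContinuousOn F (stdSimplex ℝ I) := continuousOn_finsetSum _ fun i _ => hgc i
  have hHc : ∀ i, ContinuousOn (H i) (stdSimplex ℝ I) := fun i =>
    ((continuous_apply i).continuousOn.mul hFc).sub (hgc i)
  have hHsum : ∀ t ∈ stdSimplex ℝ I, ∑ i, H i t = 0 := by
    intro t ht
    simp only [hH, Finset.sum_sub_distrib, ← Finset.sum_mul, ht.2]
    simp [hF]
  have hlab : ∀ t ∈ stdSimplex ℝ I, ∃ i, H i t ≤ 0 := by
    intro t ht
    by_contra hcon
    push Not at hcon
    have := Finset.sum_pos (fun i _ => hcon i) (Finset.univ_nonempty (α := I))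
    rw [hHsum t ht] at this
    exact lt_irrefl _ this
  -- embedding of the grid
  let emb : ∀ N : ℕ, Grid I (N + 1) → I → ℝ := fun N x i => ((x.1 i : ℕ) : ℝ) / ((N : ℝ) + 1)
  have hemb : ∀ N x, emb N x ∈ stdSimplex ℝ I := by
    intro N x
    refine ⟨fun i => by positivity, ?_⟩
    simp only [emb, ← Finset.sum_div]
    rw [← Nat.cast_sum, x.2]
    push_cast
    exact div_self (by positivity)
  set M : ℝ := (Fintype.card I : ℝ) with hM
  have hstep : ∀ N : ℕ, ∃ x0 ∈ stdSimplex ℝ I, ∃ x : I → I → ℝ, ∀ i, x i ∈ stdSimplex ℝ I ∧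
      (∀ j, |x i j - x0 j| ≤ M / ((N : ℝ) + 1)) ∧
      min (H i (x i)) (x i i) ≤ M / ((N : ℝ) + 1) := by
    intro N
    choose lab hlab' using fun x : Grid I (N + 1) => hlab (emb N x) (hemb N x)
    obtain ⟨x0, hx0⟩ := grid_lemma (N + 1) lab
    choose x hx1 hx2 using hx0
    refine ⟨emb N x0, hemb N x0, fun i => emb N (x i), fun i => ⟨hemb N _, fun j => ?_, ?_⟩⟩
    · have h1 : (((x i).1 j : ℕ) : ℝ) ≤ ((x0.1 j : ℕ) : ℝ) + M := by
        rw [hM]; exact_mod_cast (hx1 i j).1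
      have h2 : ((x0.1 j : ℕ) : ℝ) ≤ (((x i).1 j : ℕ) : ℝ) + M := by
        rw [hM]; exact_mod_cast (hx1 i j).2
      simp only [emb]
      rw [← sub_div, abs_div, abs_of_pos (show (0:ℝ) < (N:ℝ) + 1 by positivity)]
      gcongr
      rw [abs_le]
      constructor <;> linarith
    · rcases hx2 i with h1 | h1
      · refine (min_le_left _ _).trans (le_trans ?_ (show (0:ℝ) ≤ M / ((N:ℝ)+1) by positivity))
        have := hlab' (x i)
        rwa [h1] at this
      · refine (min_le_right _ _).trans ?_
        simp only [emb]
        gcongr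
        rw [hM]; exact_mod_cast h1
  choose x0 hx0 x hx using hstep
  obtain ⟨t, ht, φ, hφ, hlim⟩ := (isCompact_stdSimplex ℝ I).tendsto_subseq hx0
  have hz : Filter.Tendsto (fun N : ℕ => M / ((φ N : ℝ) + 1)) Filter.atTop (nhds 0) :=
    ((tendsto_const_div_atTop_nhds_zero_nat M).comp (Filter.tendsto_add_atTop_nat 1)).comp
      hφ.tendsto_atTop |>.congr fun N => by simp
  have hxlim : ∀ i, Filter.Tendsto (fun N => x (φ N) i) Filter.atTop (nhds t) := by
    intro i
    rw [tendsto_pi_nhds]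
    intro j
    have h1 : Filter.Tendsto (fun N => x0 (φ N) j) Filter.atTop (nhds (t j)) :=
      (tendsto_pi_nhds.mp hlim) j
    have h2 : Filter.Tendsto (fun N => x (φ N) i j - x0 (φ N) j) Filter.atTop (nhds 0) :=
      squeeze_zero_norm (fun N => (hx (φ N) i).2.1 j) hz
    simpa using h2.add h1
  have hkey : ∀ i, min (H i t) (t i) ≤ 0 := by
    intro i
    have hc : ContinuousOn (fun t => min (H i t) (t i)) (stdSimplex ℝ I) :=
      (hHc i).inf (continuous_apply i).continuousOn
    have h1 : Filter.Tendsto (fun N => x (φ N) i) Filter.atTop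
        (nhdsWithin t (stdSimplex ℝ I)) :=
      tendsto_nhdsWithin_iff.mpr ⟨hxlim i, Filter.Eventually.of_forall fun N => (hx (φ N) i).1⟩
    exact le_of_tendsto_of_tendsto ((hc t ht).tendsto.comp h1) hz
      (Filter.Eventually.of_forall fun N => (hx (φ N) i).2.2)
  have hg0 : ∀ i, 0 ≤ g i t := fun i => le_max_right _ _
  have hHle : ∀ i, H i t ≤ 0 := by
    intro i
    rcases min_le_iff.mp (hkey i) with h1 | h1
    · exact h1
    · have h2 : t i = 0 := le_antisymm h1 (ht.1 i)
      simp only [hH, h2, zero_mul, zero_sub]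
      linarith [hg0 i]
  have hHeq : ∀ i, H i t = 0 := by
    have := (Finset.sum_eq_zero_iff_of_nonpos (fun i _ => hHle i)).mp (hHsum t ht)
    exact fun i => this i (Finset.mem_univ i)
  refine ⟨t, ht, ?_⟩
  have hF0 : 0 ≤ F t := Finset.sum_nonneg fun i _ => hg0 i
  have hFz : F t = 0 := by
    by_contra hne
    have hFp : 0 < F t := lt_of_le_of_ne hF0 (Ne.symm hne)
    have hterm : ∀ i, t i * f i t = F t * (t i * t i) := by
      intro i
      have h1 : t i * F t = g i t := by have := hHeq i; simp only [hH] at this; linarith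
      by_cases hti : t i = 0
      · simp [hti]
      · have hpos : 0 < g i t := by
          rw [← h1]; exact mul_pos (lt_of_le_of_ne (ht.1 i) (Ne.symm hti)) hFp
        have : f i t = g i t := by
          simp only [hg] at hpos ⊢
          rcases lt_max_iff.mp hpos with h3 | h3
          · exact (max_eq_left h3.le).symm
          · exact absurd h3 (lt_irrefl _)
        rw [this, ← h1]; ring
    have h2 := h t ht
    simp_rw [hterm] at h2
    rw [← Finset.mul_sum] at h2
    have h3 : ∑ i, t i * t i ≤ 0 := nonpos_of_mul_nonpos_right h2 hFp
    have h4 := (Finset.sum_eq_zero_iff_of_nonneg (fun i _ => mul_self_nonneg (t i))).mp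
      (le_antisymm h3 (Finset.sum_nonneg fun i _ => mul_self_nonneg (t i)))
    have h5 : ∑ i, t i = 0 := Finset.sum_eq_zero fun i hi => mul_self_eq_zero.mp (h4 i hi)
    rw [ht.2] at h5
    exact one_ne_zero h5
  intro i
  have := (Finset.sum_eq_zero_iff_of_nonneg (fun i _ => hg0 i)).mp hFz i (Finset.mem_univ i)
  exact (le_max_left _ _).trans this.le

/-- Abstract Ky Fan inequality. -/
theorem kyfan {Z : Type*} [TopologicalSpace Z] [CompactSpace Z] [Nonempty Z] (f : Z → Z → ℝ)
    (hf : ∀ w, Continuous fun z => f z w)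
    (hmix : ∀ (m : ℕ) (w : Fin m → Z), 0 < m → ∃ ζ : (Fin m → ℝ) → Z,
      ContinuousOn ζ (stdSimplex ℝ (Fin m)) ∧
      ∀ t ∈ stdSimplex ℝ (Fin m), ∑ j, t j * f (ζ t) (w j) ≤ 0) :
    ∃ z, ∀ w, f z w ≤ 0 := by
  classical
  have hcl : ∀ w, IsClosed {z | f z w ≤ 0} := fun w => isClosed_le (hf w) continuous_const
  have := CompactSpace.iInter_nonempty hcl (by
    intro s
    rcases s.eq_empty_or_nonempty with rfl | hs
    · simp
    have hpos : 0 < s.card := Finset.card_pos.mpr hs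
    let e := s.equivFin
    obtain ⟨ζ, hζ, hle⟩ := hmix s.card (fun j => (e.symm j : Z)) hpos
    haveI : Nonempty (Fin s.card) := ⟨⟨0, hpos⟩⟩
    obtain ⟨t, ht, h⟩ := simplex_kyfan (fun j t => f (ζ t) (e.symm j : Z))
      (fun j => (hf _).comp_continuousOn hζ) hle
    refine ⟨ζ t, ?_⟩
    simp only [Set.mem_iInter, Set.mem_setOf_eq]
    intro w hw
    have := h (e ⟨w, hw⟩)
    simpa using this)
  obtain ⟨z, hz⟩ := this
  exact ⟨z, fun w => by simpa using Set.mem_iInter.mp hz w⟩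

end Scarf
end CSGame


namespace CSGame
section Verif

variable {n l : ℕ}
variable {X : Type} [Countable X] [MeasurableSpace X] [DiscreteMeasurableSpace X]
variable {A : Fin n → Type} [∀ i, MeasurableSpace (A i)] [∀ i, TopologicalSpace (A i)]
variable (G : GameData n l X A)

instance jointLaw_prob (π : MultiStrategy G) (t : ℕ) (h : Hist X (JA A) t) :
    IsProbabilityMeasure (jointLaw G π t h) := by
  unfold jointLaw; infer_instance

theorem measurable_jointLaw (π : MultiStrategy G) (t : ℕ) : Measurable (jointLaw G π t) := by
  refine Measurable.measure_of_isPiSystem_of_isProbabilityMeasure generateFrom_pi.symm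
    isPiSystem_pi ?_
  rintro s ⟨s, hs, rfl⟩
  simp only [jointLaw, Measure.pi_pi]
  exact Finset.measurable_prod _ fun i _ => (π i).meas t (s i) (hs i (Set.mem_univ i))

theorem measurable_p (x : X) : Measurable (G.p x) := by
  refine Measure.measurable_of_measurable_coe _ fun s _ => ?_
  have : (fun a => G.p x a s) = fun a => ∑' y : X, s.indicator (fun y => G.p x a {y}) y := by
    funext a
    exact ((G.p x a).tsum_indicator_apply_singleton s s.to_countable.measurableSet).symm
  rw [this]
  refine Measurable.ennreal_tsum fun y => ?_
  by_cases hy : y ∈ s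
  · simp only [Set.indicator_of_mem hy]; exact G.hpm x y
  · simp only [Set.indicator_of_notMem hy]; exact measurable_const

/-- kernel of actions -/
noncomputable def Jk (π : MultiStrategy G) (t : ℕ) : Kernel (Hist X (JA A) t) (JA A) :=
  ⟨jointLaw G π t, measurable_jointLaw G π t⟩

instance (π : MultiStrategy G) (t : ℕ) : IsMarkovKernel (Jk G π t) :=
  ⟨fun h => jointLaw_prob G π t h⟩

/-- transition kernel -/
noncomputable def Pk (π : MultiStrategy G) (t : ℕ) : Kernel (Hist X (JA A) t × JA A) X :=
  ⟨fun q => G.p (lastState X (JA A) t q.1) q.2, by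
    have h1 : Measurable (fun q : X × JA A => G.p q.1 q.2) :=
      measurable_from_prod_countable_right fun x => measurable_p G x
    exact h1.comp (((measurable_lastState X (JA A) t).comp measurable_fst).prodMk measurable_snd)⟩

instance (π : MultiStrategy G) (t : ℕ) : IsMarkovKernel (Pk G π t) :=
  ⟨fun q => G.hp _ _⟩

theorem stage_eq (π : MultiStrategy G) (t : ℕ) (h : Hist X (JA A) t) :
    ((jointLaw G π t h).bind fun a =>
          (G.p (lastState X (JA A) t h) a).map fun y =>
            (show Hist X (JA A) (t + 1) from (h, a, y))) =
    (((Jk G π t) ⊗ₖ (Pk G π t)) h).map (Prod.mk h) := by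
  refine Measure.ext fun s hs => ?_
  have hs' : MeasurableSet (α := Hist X (JA A) t × JA A × X) s := hs
  have hm : Measurable fun a : JA A => (G.p (lastState X (JA A) t h) a).map fun y =>
            (show Hist X (JA A) (t + 1) from (h, a, y)) := by
    refine Measure.measurable_of_measurable_coe _ fun s hs => ?_
    have hs' : MeasurableSet (α := Hist X (JA A) t × JA A × X) s := hs
    have h1 : ∀ a : JA A, ((G.p (lastState X (JA A) t h) a).map fun y =>
            (show Hist X (JA A) (t + 1) from (h, a, y))) s
        = (Pk G π t (h, a)) (Prod.mk a ⁻¹' (Prod.mk h ⁻¹' s)) := by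
      intro a
      rw [Measure.map_apply Measurable.of_discrete hs]
      rfl
    simp_rw [h1]
    exact Kernel.measurable_kernel_prodMk_left (κ := (Pk G π t).comap (Prod.mk h) measurable_prodMk_left)
      (measurable_prodMk_left hs')
  rw [Measure.bind_apply hs hm.aemeasurable]
  refine Eq.trans ?_ (Measure.map_apply measurable_prodMk_left hs').symm
  rw [Kernel.compProd_apply (measurable_prodMk_left hs')]
  refine lintegral_congr fun a => ?_
  rw [Measure.map_apply Measurable.of_discrete hs]
  rfl

theorem histMeas_succ (η' : Measure X) [IsProbabilityMeasure η'] (π : MultiStrategy G) (t : ℕ)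
    [IsProbabilityMeasure (histMeas G η' π t)] :
    histMeas G η' π (t + 1) =
      (histMeas G η' π t) ⊗ₘ ((Jk G π t) ⊗ₖ (Pk G π t)) := by
  have h1 : histMeas G η' π (t + 1) = (histMeas G η' π t).bind
      (fun h => (((Jk G π t) ⊗ₖ (Pk G π t)) h).map (Prod.mk h)) := by
    rw [histMeas]
    congr 1
    funext h
    exact stage_eq G π t h
  rw [h1]
  refine Measure.ext fun s hs => ?_
  have hs' : MeasurableSet (α := Hist X (JA A) t × JA A × X) s := hs
  have hm : Measurable fun h => (((Jk G π t) ⊗ₖ (Pk G π t)) h).map (Prod.mk h) := by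
    have : (fun h => (((Jk G π t) ⊗ₖ (Pk G π t)) h).map (Prod.mk h)) =
        (Kernel.id ×ₖ ((Jk G π t) ⊗ₖ (Pk G π t))) := by
      funext h
      rw [Kernel.prod_apply, Kernel.id_apply, Measure.dirac_prod]
    rw [this]
    exact Kernel.measurable _
  refine (Measure.bind_apply hs' hm.aemeasurable).trans ?_
  refine Eq.trans ?_ (Measure.compProd_apply hs').symm
  refine lintegral_congr fun h => ?_
  rw [Measure.map_apply measurable_prodMk_left hs']

instance histMeas_prob (η' : Measure X) [IsProbabilityMeasure η'] (π : MultiStrategy G) (t : ℕ) :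
    IsProbabilityMeasure (histMeas G η' π t) := by
  induction t with
  | zero => assumption
  | succ t ih =>
    rw [histMeas_succ]
    exact inferInstanceAs (IsProbabilityMeasure
      ((histMeas G η' π t) ⊗ₘ ((Jk G π t) ⊗ₖ (Pk G π t))))

theorem integrable_bdd {Ω : Type*} [MeasurableSpace Ω] {μ : Measure Ω} [IsFiniteMeasure μ]
    {f : Ω → ℝ} (hf : Measurable f) {C : ℝ} (h : ∀ x, |f x| ≤ C) : Integrable f μ :=
  Integrable.of_bound hf.aestronglyMeasurable C (Eventually.of_forall h)

theorem abs_integral_le_bdd {Ω : Type*} [MeasurableSpace Ω] {μ : Measure Ω}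
    [IsProbabilityMeasure μ] {f : Ω → ℝ} {C : ℝ} (h : ∀ x, |f x| ≤ C) :
    |∫ x, f x ∂μ| ≤ C := by
  have := norm_integral_le_of_norm_le_const (μ := μ) (f := f) (Eventually.of_forall h)
  simpa using this

theorem integral_last_succ (η' : Measure X) [IsProbabilityMeasure η'] (π : MultiStrategy G)
    (t : ℕ) (u : X → ℝ) {D : ℝ} (hu : ∀ x, |u x| ≤ D) :
    ∫ h, u (lastState X (JA A) (t + 1) h) ∂(histMeas G η' π (t + 1)) =
    ∫ h, (∫ a, (∫ y, u y ∂(G.p (lastState X (JA A) t h) a)) ∂(jointLaw G π t h))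
      ∂(histMeas G η' π t) := by
  rw [histMeas_succ]
  have hum : Measurable u := Measurable.of_discrete
  have h1 : Integrable (fun q : Hist X (JA A) t × JA A × X => u q.2.2)
      ((histMeas G η' π t) ⊗ₘ ((Jk G π t) ⊗ₖ (Pk G π t))) :=
    integrable_bdd (hum.comp (measurable_snd.comp measurable_snd)) (fun q => hu _)
  refine (Measure.integral_compProd h1).trans ?_
  refine integral_congr_ae (Eventually.of_forall fun h => ?_)
  have h2 : Integrable (fun q : JA A × X => u q.2) (((Jk G π t) ⊗ₖ (Pk G π t)) h) :=
    integrable_bdd (hum.comp measurable_snd) (fun q => hu _)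
  exact integral_compProd h2

/-- measurability of the inner stage integral -/
theorem measurable_stage (π : MultiStrategy G) (t : ℕ) {f : X → JA A → ℝ}
    (hf : ∀ x, Measurable (f x)) :
    Measurable fun h => ∫ a, f (lastState X (JA A) t h) a ∂(jointLaw G π t h) := by
  have h1 : Measurable (fun q : X × JA A => f q.1 q.2) :=
    measurable_from_prod_countable_right hf
  have h2 : Measurable (fun q : Hist X (JA A) t × JA A => f (lastState X (JA A) t q.1) q.2) :=
    h1.comp (((measurable_lastState X (JA A) t).comp measurable_fst).prodMk measurable_snd)
  exact (h2.stronglyMeasurable.integral_kernel_prod_right' (κ := Jk G π t)).measurable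

theorem measurable_pint (x : X) (u : X → ℝ) : Measurable fun a => ∫ y, u y ∂(G.p x a) := by
  have hum : StronglyMeasurable u := Measurable.of_discrete.stronglyMeasurable
  exact (StronglyMeasurable.integral_kernel (κ := ⟨G.p x, measurable_p G x⟩) hum).measurable

theorem stageExp_bdd (η' : Measure X) [IsProbabilityMeasure η'] (π : MultiStrategy G) (t : ℕ)
    {f : X → JA A → ℝ} {C : ℝ} (hb : ∀ x a, |f x a| ≤ C) : |stageExp G η' π t f| ≤ C :=
  abs_integral_le_bdd fun _ => abs_integral_le_bdd fun _ => hb _ _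

theorem summable_disc {α : ℝ} (h0 : 0 < α) (h1 : α < 1) {s : ℕ → ℝ} {C : ℝ}
    (hs : ∀ t, |s t| ≤ C) : Summable fun t => α ^ t * s t := by
  refine Summable.of_norm_bounded ((summable_geometric_of_lt_one h0.le h1).mul_right C)
    fun t => ?_
  rw [Real.norm_eq_abs, abs_mul, abs_of_pos (pow_pos h0 t)]
  exact mul_le_mul_of_nonneg_left (hs t) (pow_pos h0 t).le

/-- The verification (Bellman) lemma. -/
theorem verif (η' : Measure X) [IsProbabilityMeasure η'] (π : MultiStrategy G)
    {f : X → JA A → ℝ} (hf : ∀ x, Measurable (f x)) {C : ℝ} (hb : ∀ x a, |f x a| ≤ C)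
    (u : X → ℝ) {D : ℝ} (hu : ∀ x, |u x| ≤ D)
    (H : ∀ t h, u (lastState X (JA A) t h) ≤
      (1 - G.α) * (∫ a, f (lastState X (JA A) t h) a ∂(jointLaw G π t h)) +
      G.α * ∫ a, (∫ y, u y ∂(G.p (lastState X (JA A) t h) a)) ∂(jointLaw G π t h)) :
    ∫ x, u x ∂η' ≤ Jfun G η' f π := by
  have hum : Measurable u := Measurable.of_discrete
  set U : ℕ → ℝ := fun t => ∫ h, u (lastState X (JA A) t h) ∂(histMeas G η' π t) with hU
  have hUb : ∀ t, |U t| ≤ D := fun t => abs_integral_le_bdd fun _ => hu _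
  have hp := G.hp
  have hstep : ∀ t, U t ≤ (1 - G.α) * stageExp G η' π t f + G.α * U (t + 1) := by
    intro t
    have i1 : Integrable (fun h => ∫ a, f (lastState X (JA A) t h) a ∂(jointLaw G π t h))
        (histMeas G η' π t) :=
      integrable_bdd (measurable_stage G π t hf) (fun h => abs_integral_le_bdd fun _ => hb _ _)
    have i2 : Integrable (fun h => ∫ a, (∫ y, u y ∂(G.p (lastState X (JA A) t h) a))
        ∂(jointLaw G π t h)) (histMeas G η' π t) :=
      integrable_bdd (measurable_stage G π t (f := fun x a => ∫ y, u y ∂(G.p x a))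
        fun x => measurable_pint G x u)
        (fun h => abs_integral_le_bdd fun _ => abs_integral_le_bdd fun _ => hu _)
    have i0 : Integrable (fun h => u (lastState X (JA A) t h)) (histMeas G η' π t) :=
      integrable_bdd (hum.comp (measurable_lastState X (JA A) t)) (fun h => hu _)
    have h1 := integral_mono i0 ((i1.const_mul (1 - G.α)).add (i2.const_mul G.α)) (H t)
    rw [integral_add' (i1.const_mul (1 - G.α)) (i2.const_mul G.α), integral_const_mul,
      integral_const_mul, ← integral_last_succ G η' π t u hu] at h1
    exact h1
  have hα0 := G.hα0
  have hα1 := G.hα1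
  have hs1 : Summable fun t => G.α ^ t * stageExp G η' π t f :=
    summable_disc hα0 hα1 fun t => stageExp_bdd G η' π t hb
  have hpart : ∀ T, U 0 ≤ (1 - G.α) * ∑ t ∈ Finset.range T, G.α ^ t * stageExp G η' π t f
      + G.α ^ T * U T := by
    intro T
    induction T with
    | zero => simp
    | succ T ih =>
      rw [Finset.sum_range_succ]
      have := mul_le_mul_of_nonneg_left (hstep T) (pow_pos hα0 T).le
      rw [pow_succ]
      nlinarith
  have hlim : Tendsto (fun T => (1 - G.α) * ∑ t ∈ Finset.range T, G.α ^ t * stageExp G η' π t f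
      + G.α ^ T * U T) atTop (𝓝 ((1 - G.α) * ∑' t, G.α ^ t * stageExp G η' π t f + 0)) := by
    refine (hs1.hasSum.tendsto_sum_nat.const_mul _).add ?_
    exact (summable_disc hα0 hα1 hUb).tendsto_atTop_zero
  rw [add_zero] at hlim
  exact ge_of_tendsto' hlim hpart

theorem Jfun_sum (η' : Measure X) [IsProbabilityMeasure η'] (π : MultiStrategy G)
    {L : Type} [Fintype L] (lam : L → ℝ) (f : L → X → JA A → ℝ)
    (hf : ∀ k x, Measurable (f k x)) {C : ℝ} (hb : ∀ k x a, |f k x a| ≤ C) :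
    Jfun G η' (fun x a => ∑ k, lam k * f k x a) π = ∑ k, lam k * Jfun G η' (f k) π := by
  have h1 : ∀ t, stageExp G η' π t (fun x a => ∑ k, lam k * f k x a) =
      ∑ k, lam k * stageExp G η' π t (f k) := by
    intro t
    simp only [stageExp]
    have h2 : ∀ h, ∫ a, ∑ k, lam k * f k (lastState X (JA A) t h) a ∂(jointLaw G π t h) =
        ∑ k, lam k * ∫ a, f k (lastState X (JA A) t h) a ∂(jointLaw G π t h) := by
      intro h
      rw [integral_finsetSum _ fun k _ => (integrable_bdd (hf k _) (hb k _)).const_mul _]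
      simp_rw [integral_const_mul]
    simp_rw [h2]
    rw [integral_finsetSum _ fun k _ => (integrable_bdd (measurable_stage G π t (hf k))
      (fun h => abs_integral_le_bdd fun _ => hb k _ _)).const_mul _]
    simp_rw [integral_const_mul]
  simp only [Jfun, h1]
  have h3 : ∀ k, Summable fun t => G.α ^ t * stageExp G η' π t (f k) := fun k =>
    summable_disc G.hα0 G.hα1 fun t => stageExp_bdd G η' π t (hb k)
  have h4 : ∀ t, G.α ^ t * ∑ k, lam k * stageExp G η' π t (f k) =
      ∑ k, lam k * (G.α ^ t * stageExp G η' π t (f k)) := by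
    intro t; rw [Finset.mul_sum]; exact Finset.sum_congr rfl fun k _ => by ring
  simp_rw [h4]
  rw [Summable.tsum_finsetSum fun k _ => (h3 k).mul_left _]
  simp_rw [tsum_mul_left]
  rw [Finset.mul_sum]
  exact Finset.sum_congr rfl fun k _ => by ring

theorem Jfun_neg (η' : Measure X) (π : MultiStrategy G) (f : X → JA A → ℝ) :
    Jfun G η' (fun x a => - f x a) π = - Jfun G η' f π := by
  simp only [Jfun, stageExp, integral_neg, mul_neg, tsum_neg]

theorem verif_eq (η' : Measure X) [IsProbabilityMeasure η'] (π : MultiStrategy G)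
    {f : X → JA A → ℝ} (hf : ∀ x, Measurable (f x)) {C : ℝ} (hb : ∀ x a, |f x a| ≤ C)
    (u : X → ℝ) {D : ℝ} (hu : ∀ x, |u x| ≤ D)
    (H : ∀ t h, u (lastState X (JA A) t h) =
      (1 - G.α) * (∫ a, f (lastState X (JA A) t h) a ∂(jointLaw G π t h)) +
      G.α * ∫ a, (∫ y, u y ∂(G.p (lastState X (JA A) t h) a)) ∂(jointLaw G π t h)) :
    Jfun G η' f π = ∫ x, u x ∂η' := by
  refine le_antisymm ?_ (verif G η' π hf hb u hu fun t h => (H t h).le)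
  have := verif G η' π (f := fun x a => - f x a) (fun x => (hf x).neg) (C := C)
    (fun x a => by rw [abs_neg]; exact hb x a) (fun x => - u x) (D := D)
    (fun x => by rw [abs_neg]; exact hu x) (fun t h => by
      simp only [integral_neg, mul_neg]
      rw [H t h]; linarith)
  rw [Jfun_neg, integral_neg] at this
  linarith

end Verif
end CSGame


namespace CSGame
section Gen

/-- Existence for a (possibly infinite) family of players with affine payoffs. -/
theorem multi_kyfan {S Z : Type*} [TopologicalSpace Z] [CompactSpace Z] [Nonempty Z]
    (g : S → Z → Z → ℝ) (hg : ∀ s w, Continuous fun z => g s z w)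
    (hzero : ∀ s z, g s z z = 0)
    (hloc : ∀ s z w, ∃ w', g s z w' = g s z w ∧ ∀ s', s' ≠ s → g s' z w' = 0)
    (hmix : ∀ (m : ℕ) (w : Fin m → Z), 0 < m → ∃ ζ : (Fin m → ℝ) → Z,
      ContinuousOn ζ (stdSimplex ℝ (Fin m)) ∧
      ∀ t ∈ stdSimplex ℝ (Fin m), ∀ s z, ∑ j, t j * g s z (w j) = g s z (ζ t)) :
    ∃ z, ∀ s w, g s z w ≤ 0 := by
  classical
  have hcl : ∀ s, IsClosed {z | ∀ w, g s z w ≤ 0} := fun s => by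
    rw [Set.ofPred_forall]
    exact isClosed_iInter fun w => isClosed_le (hg s w) continuous_const
  have := CompactSpace.iInter_nonempty hcl (by
    intro F
    obtain ⟨z, hz⟩ := Scarf.kyfan (fun z w => ∑ s ∈ F, g s z w)
      (fun w => continuous_finsetSum _ fun s _ => hg s w) (by
        intro m w hm
        obtain ⟨ζ, hζ, h⟩ := hmix m w hm
        refine ⟨ζ, hζ, fun t ht => ?_⟩
        simp only [Finset.mul_sum]
        rw [Finset.sum_comm]
        refine (Finset.sum_eq_zero fun s _ => ?_).le
        rw [h t ht, hzero])
    refine ⟨z, ?_⟩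
    simp only [Set.mem_iInter, Set.mem_ofPred_eq]
    intro s hs w
    obtain ⟨w', h1, h2⟩ := hloc s z w
    have := hz w'
    rw [Finset.sum_eq_single_of_mem s hs (fun s' _ hne => h2 s' hne), h1] at this
    exact this)
  obtain ⟨z, hz⟩ := this
  exact ⟨z, fun s => by simpa using Set.mem_iInter.mp hz s⟩

theorem continuous_tsum_prob {X E : Type*} [TopologicalSpace E] (q v : X → E → ℝ)
    (hq : ∀ y, Continuous (q y)) (hv : ∀ y, Continuous (v y)) (hq0 : ∀ y e, 0 ≤ q y e)
    (hq1 : ∀ e, HasSum (fun y => q y e) 1) {C : ℝ} (hC : 0 ≤ C) (hvC : ∀ y e, |v y e| ≤ C) :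
    Continuous fun e => ∑' y, q y e * v y e := by
  refine continuous_of_locally_uniform_approx_of_continuousAt fun e0 u hu => ?_
  obtain ⟨ε, hε, hεu⟩ := Metric.mem_uniformity_dist.mp hu
  have hδ : 0 < ε / (C + 1) := by positivity
  obtain ⟨F, hF⟩ := ((hq1 e0).eventually (lt_mem_nhds (show 1 - ε / (C + 1) < 1 by linarith))).exists
  have hcF : Continuous fun e => ∑ y ∈ F, q y e := continuous_finsetSum _ fun y _ => hq y
  refine ⟨_, hcF.continuousAt.eventually (lt_mem_nhds hF), fun e => ∑ y ∈ F, q y e * v y e,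
    (continuous_finsetSum _ fun y _ => (hq y).mul (hv y)).continuousAt, fun e he => hεu ?_⟩
  have he' : 1 - ε / (C + 1) < ∑ y ∈ F, q y e := he
  have hle : ∀ y, |q y e * v y e| ≤ q y e * C := fun y => by
    rw [abs_mul, abs_of_nonneg (hq0 y e)]
    exact mul_le_mul_of_nonneg_left (hvC y e) (hq0 y e)
  have hsC : Summable fun y => q y e * C := (hq1 e).summable.mul_right C
  have hs : Summable fun y => q y e * v y e := Summable.of_norm_bounded hsC hle
  have hsub : ∀ F : Finset X, Summable fun y : {y // y ∉ F} => q y e * C := fun F =>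
    hsC.comp_injective Subtype.val_injective
  rw [Real.dist_eq, ← hs.sum_add_tsum_subtype_compl F, add_sub_cancel_left]
  have h1 : |∑' y : {y // y ∉ F}, q y e * v y e| ≤ ∑' y : {y // y ∉ F}, q y e * C := by
    rw [← Real.norm_eq_abs]
    exact tsum_of_norm_bounded (hsub F).hasSum fun y => hle y
  have h2 := hsC.sum_add_tsum_subtype_compl F
  rw [((hq1 e).mul_right C).tsum_eq, ← Finset.sum_mul] at h2
  refine h1.trans_lt ?_
  have h3 : (1 - ε / (C + 1)) * C ≤ (∑ y ∈ F, q y e) * C :=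
    mul_le_mul_of_nonneg_right he'.le hC
  have h4 : ε / (C + 1) * C < ε := by
    rw [div_mul_eq_mul_div, div_lt_iff₀ (by linarith)]
    nlinarith
  linarith

theorem continuous_integral_prob {Z E : Type*} [TopologicalSpace Z] [TopologicalSpace E]
    [CompactSpace E] [MeasurableSpace E] [OpensMeasurableSpace E]
    (g : Z → E → ℝ) (hg : Continuous fun q : Z × E => g q.1 q.2)
    (μ : Z → ProbabilityMeasure E) (hμ : Continuous μ) :
    Continuous fun z => ∫ e, g z e ∂(μ z : Measure E) := by
  let G : Z → C(E, ℝ) := fun z => ⟨g z, hg.comp (Continuous.prodMk_right z)⟩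
  have hG : Continuous G := ContinuousMap.continuous_of_continuous_uncurry _ hg
  rw [continuous_iff_continuousAt]
  intro z0
  have h1 : Tendsto (fun z => ∫ e, g z0 e ∂(μ z : Measure E)) (𝓝 z0)
      (𝓝 (∫ e, g z0 e ∂(μ z0 : Measure E))) :=
    (ProbabilityMeasure.tendsto_iff_forall_integral_tendsto.mp hμ.continuousAt)
      (BoundedContinuousFunction.mkOfCompact (G z0))
  have hintg : ∀ z z', Integrable (g z) (μ z' : Measure E) := fun z z' =>
    (BoundedContinuousFunction.mkOfCompact (G z)).integrable _
  have h2 : Tendsto (fun z => ∫ e, g z e ∂(μ z : Measure E) - ∫ e, g z0 e ∂(μ z : Measure E))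
      (𝓝 z0) (𝓝 0) := by
    refine squeeze_zero_norm (a := fun z => ‖G z - G z0‖) (fun z => ?_) ?_
    · rw [← integral_sub (hintg _ _) (hintg _ _)]
      refine (norm_integral_le_of_norm_le_const (C := ‖G z - G z0‖)
        (Eventually.of_forall fun e => ?_)).trans (by simp)
      exact (G z - G z0).norm_coe_le_norm e
    · have : Continuous fun z => ‖G z - G z0‖ := (hG.sub continuous_const).norm
      have h := this.tendsto z0
      simpa using h
  have := h2.add h1
  simpa [ContinuousAt] using this

/-- mixture of probability measures -/
theorem exists_mix {E : Type*} [MeasurableSpace E] [TopologicalSpace E] [OpensMeasurableSpace E]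
    {m : ℕ} (hm : 0 < m) (μ : Fin m → ProbabilityMeasure E) :
    ∃ ζ : (Fin m → ℝ) → ProbabilityMeasure E, ContinuousOn ζ (stdSimplex ℝ (Fin m)) ∧
      ∀ t ∈ stdSimplex ℝ (Fin m),
        (ζ t : Measure E) = ∑ j, ENNReal.ofReal (t j) • (μ j : Measure E) := by
  classical
  have hp : ∀ t ∈ stdSimplex ℝ (Fin m),
      IsProbabilityMeasure (∑ j, ENNReal.ofReal (t j) • (μ j : Measure E)) := by
    intro t ht
    refine ⟨?_⟩
    simp only [Measure.coe_finsetSum, Finset.sum_apply, Measure.smul_apply, measure_univ,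
      smul_eq_mul, mul_one]
    rw [← ENNReal.ofReal_sum_of_nonneg (fun j _ => ht.1 j), ht.2, ENNReal.ofReal_one]
  let ζ : (Fin m → ℝ) → ProbabilityMeasure E := fun t =>
    if ht : t ∈ stdSimplex ℝ (Fin m) then ⟨_, hp t ht⟩ else μ ⟨0, hm⟩
  have hζ : ∀ t ∈ stdSimplex ℝ (Fin m),
      (ζ t : Measure E) = ∑ j, ENNReal.ofReal (t j) • (μ j : Measure E) := by
    intro t ht
    have h : ζ t = ⟨_, hp t ht⟩ := dif_pos ht
    rw [h]
    rfl
  refine ⟨ζ, ?_, hζ⟩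
  intro t0 ht0
  refine ProbabilityMeasure.tendsto_iff_forall_integral_tendsto.mpr fun f => ?_
  have hI : ∀ t ∈ stdSimplex ℝ (Fin m), ∫ e, f e ∂(ζ t : Measure E) =
      ∑ j, t j * ∫ e, f e ∂(μ j : Measure E) := by
    intro t ht
    rw [hζ t ht, integral_finsetSum_measure]
    · refine Finset.sum_congr rfl fun j _ => ?_
      rw [integral_smul_measure, ENNReal.toReal_ofReal (ht.1 j), smul_eq_mul]
    · intro j _
      exact (f.integrable _).smul_measure ENNReal.ofReal_ne_top
  rw [hI t0 ht0]
  have hc : Continuous fun t : Fin m → ℝ => ∑ j, t j * ∫ e, f e ∂(μ j : Measure E) := by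
    fun_prop
  refine (hc.continuousWithinAt.tendsto (s := stdSimplex ℝ (Fin m)) (x := t0)).congr' ?_
  filter_upwards [self_mem_nhdsWithin] with t ht
  exact (hI t ht).symm

theorem pi_update_mix {ι : Type*} [Fintype ι] [DecidableEq ι] {E : ι → Type*}
    [∀ i, MeasurableSpace (E i)]
    (φ : ∀ i, ProbabilityMeasure (E i)) (i : ι) {m : ℕ} (t : Fin m → ℝ)
    (μ : Fin m → ProbabilityMeasure (E i)) (ν : ProbabilityMeasure (E i))
    (hν : (ν : Measure (E i)) = ∑ j, ENNReal.ofReal (t j) • (μ j : Measure (E i))) :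
    Measure.pi (fun k => (Function.update φ i ν k : Measure (E k))) =
      ∑ j, ENNReal.ofReal (t j) •
        Measure.pi (fun k => (Function.update φ i (μ j) k : Measure (E k))) := by
  refine Measure.pi_eq (μ := fun k => (Function.update φ i ν k : Measure (E k))) fun s _ => ?_
  have key : ∀ ρ : ProbabilityMeasure (E i),
      ∏ k, (Function.update φ i ρ k : Measure (E k)) (s k) =
      (ρ : Measure (E i)) (s i) * ∏ k ∈ Finset.univ.erase i, (φ k : Measure (E k)) (s k) := by
    intro ρ
    rw [← Finset.mul_prod_erase _ _ (Finset.mem_univ i)]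
    congr 1
    · simp
    · refine Finset.prod_congr rfl fun k hk => ?_
      rw [Function.update_of_ne (Finset.ne_of_mem_erase hk)]
  simp only [Measure.coe_finsetSum, Finset.sum_apply, Measure.smul_apply, Measure.pi_pi,
    smul_eq_mul, key]
  rw [hν]
  simp only [Measure.coe_finsetSum, Finset.sum_apply, Measure.smul_apply, smul_eq_mul]
  rw [Finset.sum_mul]
  exact Finset.sum_congr rfl fun j _ => by ring

theorem integral_pi_update_mix {ι : Type*} [Fintype ι] [DecidableEq ι] {E : ι → Type*}
    [∀ i, MeasurableSpace (E i)]
    (φ : ∀ i, ProbabilityMeasure (E i)) (i : ι) {m : ℕ} (t : Fin m → ℝ) (ht : ∀ j, 0 ≤ t j)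
    (μ : Fin m → ProbabilityMeasure (E i)) (ν : ProbabilityMeasure (E i))
    (hν : (ν : Measure (E i)) = ∑ j, ENNReal.ofReal (t j) • (μ j : Measure (E i)))
    (f : (∀ i, E i) → ℝ)
    (hf : ∀ μ : ProbabilityMeasure (∀ i, E i), Integrable f (μ : Measure (∀ i, E i))) :
    ∫ e, f e ∂(ProbabilityMeasure.pi (Function.update φ i ν) : Measure (∀ i, E i)) =
      ∑ j, t j * ∫ e, f e ∂(ProbabilityMeasure.pi (Function.update φ i (μ j)) :
        Measure (∀ i, E i)) := by
  rw [ProbabilityMeasure.toMeasure_pi, pi_update_mix φ i t μ ν hν, integral_finsetSum_measure]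
  · refine Finset.sum_congr rfl fun j _ => ?_
    rw [integral_smul_measure, ENNReal.toReal_ofReal (ht j), smul_eq_mul]
    rfl
  · intro j _
    exact (hf (ProbabilityMeasure.pi (Function.update φ i (μ j)))).smul_measure
      ENNReal.ofReal_ne_top

end Gen
end CSGame


namespace CSGame
section Conc
set_option linter.unusedSectionVars false

variable {n l : ℕ}
variable {X : Type} [Countable X] [MeasurableSpace X] [DiscreteMeasurableSpace X]
variable {A : Fin n → Type} [∀ i, MeasurableSpace (A i)] [∀ i, TopologicalSpace (A i)]
  [∀ i, PolishSpace (A i)] [∀ i, BorelSpace (A i)]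
variable (G : GameData n l X A)

/-- Admissible actions as a type. -/
abbrev BB (x : X) (i : Fin n) : Type := ↥(G.As i x)

/-- Admissible joint actions as a type. -/
abbrev JB (x : X) : Type := (i : Fin n) → BB G x i

instance (x : X) (i : Fin n) : CompactSpace (BB G x i) :=
  isCompact_iff_compactSpace.mp (G.hAs_cpt i x)

instance (x : X) (i : Fin n) : Nonempty (BB G x i) := (G.hAs_ne i x).to_subtype

/-- inclusion -/
def jval (x : X) (b : JB G x) : JA A := fun i => (b i : A i)

theorem jval_mem (x : X) (b : JB G x) : jval G x b ∈ jointSet G x := fun i _ => (b i).2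

theorem continuous_jval (x : X) : Continuous (jval G x) :=
  continuous_pi fun i => continuous_subtype_val.comp (continuous_apply i)

theorem measurable_jval (x : X) : Measurable (jval G x) :=
  measurable_pi_lambda _ fun i => measurable_subtype_coe.comp (measurable_pi_apply i)

theorem measurableSet_As (i : Fin n) (x : X) : MeasurableSet (G.As i x) :=
  (G.hAs_cpt i x).isClosed.measurableSet

theorem continuous_c (hA : AssumptionA G) (i : Fin n) (ℓ : Fin (l + 1)) (x : X) :
    Continuous fun b => G.c i ℓ x (jval G x b) :=
  (hA.2 i ℓ x).comp_continuous (continuous_jval G x) (jval_mem G x)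

theorem continuous_preal (hA : AssumptionA G) (x y : X) :
    Continuous fun b => (G.p x (jval G x b)).real {y} := by
  have h := (hA.1 x y).comp_continuous (continuous_jval G x) (jval_mem G x)
  have := G.hp x
  refine continuous_iff_continuousAt.mpr fun b => ?_
  exact (ENNReal.tendsto_toReal (measure_ne_top _ _)).comp h.continuousAt

theorem hasSum_real (μ : Measure X) [IsProbabilityMeasure μ] :
    HasSum (fun y => μ.real {y}) 1 := by
  have h : ∑' y, μ {y} = 1 := by
    have := μ.tsum_indicator_apply_singleton Set.univ MeasurableSet.univ
    simpa using this
  have h2 : HasSum (fun y => μ {y}) 1 := h ▸ ENNReal.summable.hasSum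
  have := ENNReal.hasSum_toReal (f := fun y => μ {y}) (by rw [h]; simp)
  rw [← ENNReal.tsum_toReal_eq (fun y => measure_ne_top _ _), h] at this
  simpa [Measure.real] using this

theorem integral_eq_tsum_real (μ : Measure X) [IsProbabilityMeasure μ] (v : X → ℝ) {C : ℝ}
    (hv : ∀ x, |v x| ≤ C) : ∫ y, v y ∂μ = ∑' y, μ.real {y} * v y := by
  rw [integral_countable (integrable_bdd Measurable.of_discrete hv)]
  rfl

theorem continuous_pint (hA : AssumptionA G) (x : X) {Z : Type*} [TopologicalSpace Z]
    (v : Z → X → ℝ) (hv : ∀ y, Continuous fun z => v z y) {C : ℝ} (hC : 0 ≤ C)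
    (hvC : ∀ z y, |v z y| ≤ C) :
    Continuous fun q : Z × JB G x => ∫ y, v q.1 y ∂(G.p x (jval G x q.2)) := by
  have := G.hp x
  have h : ∀ q : Z × JB G x, ∫ y, v q.1 y ∂(G.p x (jval G x q.2)) =
      ∑' y, (G.p x (jval G x q.2)).real {y} * v q.1 y := fun q =>
    integral_eq_tsum_real _ _ (hvC q.1)
  simp_rw [h]
  exact continuous_tsum_prob (fun y (q : Z × JB G x) => (G.p x (jval G x q.2)).real {y})
    (fun y q => v q.1 y) (fun y => (continuous_preal G hA x y).comp continuous_snd)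
    (fun y => (hv y).comp continuous_fst) (fun _ _ => measureReal_nonneg)
    (fun q => hasSum_real _) hC (fun y q => hvC q.1 y)

theorem continuous_eta {Z : Type*} [TopologicalSpace Z]
    (v : Z → X → ℝ) (hv : ∀ y, Continuous fun z => v z y) {C : ℝ} (hC : 0 ≤ C)
    (hvC : ∀ z y, |v z y| ≤ C) :
    Continuous fun z => ∫ y, v z y ∂G.η := by
  have := G.hη
  simp_rw [fun z => integral_eq_tsum_real G.η (v z) (hvC z)]
  exact continuous_tsum_prob (fun y _ => G.η.real {y}) (fun y z => v z y)
    (fun _ => continuous_const) hv (fun _ _ => measureReal_nonneg)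
    (fun _ => hasSum_real _) hC (fun y z => hvC z y)

/-- Push a measure on admissible actions to the action space. -/
theorem exists_restr (x : X) (i : Fin n) (μ : ProbabilityMeasure (A i)) (h : μ (G.As i x) = 1) :
    ∃ ν : ProbabilityMeasure (BB G x i),
      (μ : Measure (A i)) = (ν : Measure (BB G x i)).map Subtype.val := by
  have hms := measurableSet_As G i x
  have h1 : (μ : Measure (A i)) (G.As i x) = 1 := by
    rw [← ProbabilityMeasure.ennreal_coeFn_eq_coeFn_toMeasure, h]; rfl
  have hmap : ((μ : Measure (A i)).comap (Subtype.val : BB G x i → A i)).map Subtype.val =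
      (μ : Measure (A i)) := by
    rw [map_comap_subtype_coe hms]
    exact Measure.restrict_eq_self_of_ae_mem ((prob_compl_eq_zero_iff hms).mpr h1)
  refine ⟨⟨(μ : Measure (A i)).comap Subtype.val, ⟨?_⟩⟩, hmap.symm⟩
  have h2 := congrArg (fun ρ : Measure (A i) => ρ Set.univ) hmap
  rw [Measure.map_apply measurable_subtype_coe MeasurableSet.univ] at h2
  simpa using h2

theorem pi_map_jval (x : X) (ν : ∀ i, ProbabilityMeasure (BB G x i)) :
    Measure.pi (fun i => (ν i : Measure (BB G x i)).map (Subtype.val : BB G x i → A i)) =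
      (ProbabilityMeasure.pi ν : Measure (JB G x)).map (jval G x) := by
  rw [ProbabilityMeasure.toMeasure_pi]
  exact (Measure.pi_map_pi (μ := fun i => (ν i : Measure (BB G x i)))
    (f := fun i => (Subtype.val : BB G x i → A i))
    (fun i => measurable_subtype_coe.aemeasurable)).symm

theorem integral_pi_map (x : X) (ν : ∀ i, ProbabilityMeasure (BB G x i)) (f : JA A → ℝ)
    (hf : Measurable f) :
    ∫ a, f a ∂(Measure.pi (fun i => (ν i : Measure (BB G x i)).map
      (Subtype.val : BB G x i → A i))) =
    ∫ b, f (jval G x b) ∂(ProbabilityMeasure.pi ν : Measure (JB G x)) := by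
  rw [pi_map_jval, integral_map (measurable_jval G x).aemeasurable hf.aestronglyMeasurable]

/-- Stationary profile from a family of measures on admissible actions. -/
noncomputable def toStat (φ : ∀ x i, ProbabilityMeasure (BB G x i)) : StatProfile G := fun i =>
  ⟨fun x => (φ x i).map (measurable_subtype_coe.aemeasurable), fun x => by
    have h : ((φ x i).map (f := (Subtype.val : BB G x i → A i))
        (measurable_subtype_coe.aemeasurable) : Measure (A i)) (G.As i x) = 1 := by
      rw [ProbabilityMeasure.toMeasure_map,
        Measure.map_apply measurable_subtype_coe (measurableSet_As G i x)]
      simp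
    rw [← ENNReal.coe_inj, ProbabilityMeasure.ennreal_coeFn_eq_coeFn_toMeasure, h]; rfl⟩

theorem jointLaw_toStat (φ : ∀ x i, ProbabilityMeasure (BB G x i)) (t : ℕ)
    (h : Hist X (JA A) t) :
    jointLaw G (ofStatAll G (toStat G φ)) t h =
      Measure.pi (fun i => (φ (lastState X (JA A) t h) i : Measure _).map
        (Subtype.val : BB G (lastState X (JA A) t h) i → A i)) := rfl

theorem jointLaw_combine (φ : ∀ x i, ProbabilityMeasure (BB G x i)) (i : Fin n)
    (σ : Strategy G i) (t : ℕ) (h : Hist X (JA A) t) :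
    ∃ ν : ProbabilityMeasure (BB G (lastState X (JA A) t h) i),
    jointLaw G (combine G (ofStatAll G (toStat G φ)) i σ) t h =
      Measure.pi (fun k => (Function.update (φ (lastState X (JA A) t h)) i ν k : Measure _).map
        (Subtype.val : BB G (lastState X (JA A) t h) k → A k)) := by
  obtain ⟨ν, hν⟩ := exists_restr G _ i (σ.f t h) (σ.supp t h)
  refine ⟨ν, ?_⟩
  unfold jointLaw
  congr 1
  funext k
  by_cases hk : k = i
  · subst hk
    simp only [combine, Function.update_self]
    exact hν
  · simp only [combine, Function.update_of_ne hk]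
    rfl

end Conc
end CSGame


namespace CSGame
section Fix
set_option linter.unusedSectionVars false

variable {n l : ℕ}
variable {X : Type} [Countable X] [MeasurableSpace X] [DiscreteMeasurableSpace X]
variable {A : Fin n → Type} [∀ i, MeasurableSpace (A i)] [∀ i, TopologicalSpace (A i)]
  [∀ i, PolishSpace (A i)] [∀ i, BorelSpace (A i)]
variable (G : GameData n l X A)

/-- one-step cost-to-go -/
noncomputable def QQ (i : Fin n) (ℓ : Fin (l + 1)) (v : X → ℝ) (x : X) (b : JB G x) : ℝ :=
  (1 - G.α) * G.c i ℓ x (jval G x b) + G.α * ∫ y, v y ∂(G.p x (jval G x b))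

/-- the compact space of the fixed point problem -/
abbrev ZZ (C : ℝ) : Type := (∀ x i, ProbabilityMeasure (BB G x i)) ×
  (Fin n → stdSimplex ℝ (Fin (l + 1))) × (Fin n → Fin (l + 1) → X → Set.Icc (-C) C)

/-- the auxiliary players -/
inductive PL (n l : ℕ) (X : Type)
  | mn (i : Fin n) (x : X)
  | mu (i : Fin n)
  | va (i : Fin n) (ℓ : Fin (l + 1)) (x : X)

variable {G}

/-- value function component -/
def zv {C : ℝ} (z : ZZ G C) (i : Fin n) (ℓ : Fin (l + 1)) (x : X) : ℝ := (z.2.2 i ℓ x : ℝ)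

/-- multiplier component -/
def zl {C : ℝ} (z : ZZ G C) (i : Fin n) (ℓ : Fin (l + 1)) : ℝ := (z.2.1 i).1 ℓ

variable (G)

/-- constraint excess -/
noncomputable def EE (i : Fin n) (ℓ : Fin (l + 1)) (v : X → ℝ) : ℝ :=
  if ℓ = 0 then 0 else (∫ y, v y ∂G.η) - G.κ i ℓ

/-- Lagrangian one-step cost-to-go -/
noncomputable def HH (i : Fin n) (lam : Fin (l + 1) → ℝ) (v : Fin (l + 1) → X → ℝ) (x : X)
    (b : JB G x) : ℝ := ∑ ℓ, lam ℓ * QQ G i ℓ (v ℓ) x b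

/-- payoffs of the auxiliary players -/
noncomputable def gg (C : ℝ) : PL n l X → ZZ G C → ZZ G C → ℝ
  | .mn i x, z, w =>
      (∫ b, HH G i (zl z i) (zv z i) x b ∂(ProbabilityMeasure.pi (z.1 x) : Measure (JB G x))) -
      ∫ b, HH G i (zl z i) (zv z i) x b
        ∂(ProbabilityMeasure.pi (Function.update (z.1 x) i (w.1 x i)) : Measure (JB G x))
  | .mu i, z, w => ∑ ℓ, (zl w i ℓ - zl z i ℓ) * EE G i ℓ (zv z i ℓ)
  | .va i ℓ x, z, w => (zv z i ℓ x - zv w i ℓ x) *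
      (zv z i ℓ x - ∫ b, QQ G i ℓ (zv z i ℓ) x b
        ∂(ProbabilityMeasure.pi (z.1 x) : Measure (JB G x)))

theorem zv_abs {C : ℝ} (z : ZZ G C) (i : Fin n) (ℓ : Fin (l + 1)) (x : X) : |zv z i ℓ x| ≤ C :=
  abs_le.mpr (z.2.2 i ℓ x).2

theorem continuous_zv {C : ℝ} (i : Fin n) (ℓ : Fin (l + 1)) (x : X) :
    Continuous fun z : ZZ G C => zv z i ℓ x := by
  unfold zv; fun_prop

theorem continuous_zl {C : ℝ} (i : Fin n) (ℓ : Fin (l + 1)) :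
    Continuous fun z : ZZ G C => zl z i ℓ := by
  have h : Continuous fun z : ZZ G C => z.2.1 i := by fun_prop
  exact (continuous_apply ℓ).comp (continuous_subtype_val.comp h)

theorem continuous_QQ (hA : AssumptionA G) {C : ℝ} (hC : 0 ≤ C) (i : Fin n) (ℓ : Fin (l + 1))
    (x : X) : Continuous fun q : ZZ G C × JB G x => QQ G i ℓ (zv q.1 i ℓ) x q.2 := by
  unfold QQ
  exact (continuous_const.mul ((continuous_c G hA i ℓ x).comp continuous_snd)).add
    (continuous_const.mul (continuous_pint G hA x (fun (z : ZZ G C) => zv z i ℓ)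
      (fun y => continuous_zv G i ℓ y) hC (fun z y => zv_abs G z i ℓ y)))

theorem continuous_HH (hA : AssumptionA G) {C : ℝ} (hC : 0 ≤ C) (i : Fin n)
    (x : X) : Continuous fun q : ZZ G C × JB G x => HH G i (zl q.1 i) (zv q.1 i) x q.2 := by
  unfold HH
  exact continuous_finsetSum _ fun ℓ _ =>
    ((continuous_zl G i ℓ).comp continuous_fst).mul (continuous_QQ G hA hC i ℓ x)

theorem continuous_EE {C : ℝ} (hC : 0 ≤ C) (i : Fin n) (ℓ : Fin (l + 1)) :
    Continuous fun z : ZZ G C => EE G i ℓ (zv z i ℓ) := by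
  unfold EE
  split_ifs
  · exact continuous_const
  · exact (continuous_eta G (fun (z : ZZ G C) => zv z i ℓ)
      (fun y => continuous_zv G i ℓ y) hC (fun z y => zv_abs G z i ℓ y)).sub continuous_const

theorem continuous_gg (hA : AssumptionA G) {C : ℝ} (hC : 0 ≤ C) (s : PL n l X) (w : ZZ G C) :
    Continuous fun z => gg G C s z w := by
  have hx : ∀ x, Continuous fun z : ZZ G C => z.1 x := fun x =>
    (continuous_apply x).comp continuous_fst
  cases s with
  | mn i x =>
    refine (continuous_integral_prob _ (continuous_HH G hA hC i x) _
      (ProbabilityMeasure.continuous_pi.comp (hx x))).sub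
      (continuous_integral_prob _ (continuous_HH G hA hC i x) _
      (ProbabilityMeasure.continuous_pi.comp ((hx x).update i continuous_const)))
  | mu i =>
    exact continuous_finsetSum _ fun ℓ _ =>
      (continuous_const.sub (continuous_zl G i ℓ)).mul (continuous_EE G hC i ℓ)
  | va i ℓ x =>
    exact ((continuous_zv G i ℓ x).sub continuous_const).mul
      ((continuous_zv G i ℓ x).sub (continuous_integral_prob _ (continuous_QQ G hA hC i ℓ x) _
      (ProbabilityMeasure.continuous_pi.comp (hx x))))

theorem gg_zero {C : ℝ} (s : PL n l X) (z : ZZ G C) : gg G C s z z = 0 := by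
  cases s <;> simp [gg]

theorem gg_loc {C : ℝ} (s : PL n l X) (z w : ZZ G C) :
    ∃ w', gg G C s z w' = gg G C s z w ∧ ∀ s', s' ≠ s → gg G C s' z w' = 0 := by
  classical
  cases s with
  | mn i x =>
    refine ⟨(Function.update z.1 x (Function.update (z.1 x) i (w.1 x i)), z.2), ?_, ?_⟩
    · simp [gg]
    · intro s' hs'
      cases s' with
      | mn i' x' =>
        by_cases hx : x' = x
        · subst hx
          by_cases hi : i' = i
          · subst hi; exact absurd rfl hs'
          · simp [gg, Function.update_of_ne hi]
        · simp [gg, Function.update_of_ne hx]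
      | mu i => simp [gg, zl]
      | va i ℓ x => simp [gg, zv]
  | mu i =>
    refine ⟨(z.1, Function.update z.2.1 i (w.2.1 i), z.2.2), ?_, ?_⟩
    · simp [gg, zl]
    · intro s' hs'
      cases s' with
      | mn i' x' => simp [gg]
      | mu i' =>
        by_cases hi : i' = i
        · subst hi; exact absurd rfl hs'
        · simp [gg, zl, Function.update_of_ne hi]
      | va i ℓ x => simp [gg, zv]
  | va i ℓ x =>
    refine ⟨(z.1, z.2.1, Function.update z.2.2 i (Function.update (z.2.2 i) ℓ
      (Function.update (z.2.2 i ℓ) x (w.2.2 i ℓ x)))), ?_, ?_⟩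
    · simp [gg, zv]
    · intro s' hs'
      cases s' with
      | mn i' x' => simp [gg]
      | mu i' => simp [gg, zl]
      | va i' ℓ' x' =>
        by_cases hi : i' = i
        · subst hi
          by_cases hl : ℓ' = ℓ
          · subst hl
            by_cases hx : x' = x
            · subst hx; exact absurd rfl hs'
            · simp [gg, zv, Function.update_of_ne hx]
          · simp [gg, zv, Function.update_of_ne hl]
        · simp [gg, zv, Function.update_of_ne hi]

theorem exists_mix_convex {E : Type*} [AddCommGroup E] [Module ℝ E] [TopologicalSpace E]
    [ContinuousAdd E] [ContinuousSMul ℝ E] {K : Set E} (hK : Convex ℝ K) {m : ℕ} (hm : 0 < m)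
    (w : Fin m → K) : ∃ ζ : (Fin m → ℝ) → K, ContinuousOn ζ (stdSimplex ℝ (Fin m)) ∧
      ∀ t ∈ stdSimplex ℝ (Fin m), (ζ t : E) = ∑ j, t j • (w j : E) := by
  classical
  have hp : ∀ t ∈ stdSimplex ℝ (Fin m), ∑ j, t j • (w j : E) ∈ K := fun t ht =>
    hK.sum_mem (fun j _ => ht.1 j) ht.2 (fun j _ => (w j).2)
  let ζ : (Fin m → ℝ) → K := fun t =>
    if ht : t ∈ stdSimplex ℝ (Fin m) then ⟨_, hp t ht⟩ else w ⟨0, hm⟩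
  have hζ : ∀ t ∈ stdSimplex ℝ (Fin m), (ζ t : E) = ∑ j, t j • (w j : E) := by
    intro t ht
    have h : ζ t = ⟨_, hp t ht⟩ := dif_pos ht
    rw [h]
  refine ⟨ζ, ?_, hζ⟩
  rw [Topology.IsInducing.subtypeVal.continuousOn_iff]
  have hc : Continuous fun t : Fin m → ℝ => ∑ j, t j • (w j : E) := by fun_prop
  exact hc.continuousOn.congr fun t ht => hζ t ht

theorem gg_mix (hA : AssumptionA G) {C : ℝ} (hC : 0 ≤ C) (m : ℕ) (w : Fin m → ZZ G C)
    (hm : 0 < m) : ∃ ζ : (Fin m → ℝ) → ZZ G C,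
      ContinuousOn ζ (stdSimplex ℝ (Fin m)) ∧
      ∀ t ∈ stdSimplex ℝ (Fin m), ∀ s z, ∑ j, t j * gg G C s z (w j) = gg G C s z (ζ t) := by
  classical
  choose ζ1 h1c h1 using fun x i => exists_mix hm fun j => (w j).1 x i
  choose ζ2 h2c h2 using fun i =>
    exists_mix_convex (convex_stdSimplex ℝ (Fin (l + 1))) hm fun j => (w j).2.1 i
  choose ζ3 h3c h3 using fun i ℓ x =>
    exists_mix_convex (convex_Icc (-C) C) hm fun j => (w j).2.2 i ℓ x
  refine ⟨fun t => (fun x i => ζ1 x i t, fun i => ζ2 i t, fun i ℓ x => ζ3 i ℓ x t), ?_, ?_⟩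
  · refine ContinuousOn.prodMk ?_ (ContinuousOn.prodMk ?_ ?_)
    · exact continuousOn_pi.mpr fun x => continuousOn_pi.mpr fun i => h1c x i
    · exact continuousOn_pi.mpr fun i => h2c i
    · exact continuousOn_pi.mpr fun i => continuousOn_pi.mpr fun ℓ =>
        continuousOn_pi.mpr fun x => h3c i ℓ x
  · intro t ht s z
    cases s with
    | mn i x =>
      have hintg : ∀ μ : ProbabilityMeasure (JB G x),
          Integrable (fun b => HH G i (zl z i) (zv z i) x b) (μ : Measure (JB G x)) := fun μ =>
        (BoundedContinuousFunction.mkOfCompact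
          ⟨fun b => HH G i (zl z i) (zv z i) x b,
            (continuous_HH G hA hC i x).comp (Continuous.prodMk_right z)⟩).integrable _
      have := integral_pi_update_mix (z.1 x) i t ht.1 (fun j => (w j).1 x i) (ζ1 x i t)
        (h1 x i t ht) _ hintg
      simp only [gg]
      rw [this]
      simp only [mul_sub, Finset.sum_sub_distrib]
      rw [← Finset.sum_mul, ht.2, one_mul]
    | mu i =>
      simp only [gg, Finset.mul_sum]
      rw [Finset.sum_comm]
      refine Finset.sum_congr rfl fun ℓ _ => ?_
      have : (ζ2 i t).1 ℓ = ∑ j, t j * zl (w j) i ℓ := by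
        rw [h2 i t ht]
        simp [zl]
      simp only [← mul_assoc]
      rw [← Finset.sum_mul]
      congr 1
      simp only [mul_sub, Finset.sum_sub_distrib]
      rw [← Finset.sum_mul, ht.2, one_mul, ← this]
      rfl
    | va i ℓ x =>
      simp only [gg, ← mul_assoc]
      rw [← Finset.sum_mul]
      congr 1
      have : (ζ3 i ℓ x t : ℝ) = ∑ j, t j * zv (w j) i ℓ x := by
        rw [h3 i ℓ x t ht]
        simp [zv]
      simp only [mul_sub, Finset.sum_sub_distrib]
      rw [← Finset.sum_mul, ht.2, one_mul, ← this]
      rfl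

theorem exists_fix (hA : AssumptionA G) {C : ℝ} (hC : 0 ≤ C)
    (hb : ∀ i ℓ x a, |G.c i ℓ x a| ≤ C) :
    ∃ (φ : ∀ x i, ProbabilityMeasure (BB G x i)) (lam : Fin n → Fin (l + 1) → ℝ)
      (v : Fin n → Fin (l + 1) → X → ℝ),
      (∀ i, lam i ∈ stdSimplex ℝ (Fin (l + 1))) ∧ (∀ i ℓ x, |v i ℓ x| ≤ C) ∧
      (∀ i ℓ x, v i ℓ x =
        ∫ b, QQ G i ℓ (v i ℓ) x b ∂(ProbabilityMeasure.pi (φ x) : Measure (JB G x))) ∧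
      (∀ i, ∀ w ∈ stdSimplex ℝ (Fin (l + 1)),
        ∑ ℓ, w ℓ * EE G i ℓ (v i ℓ) ≤ ∑ ℓ, lam i ℓ * EE G i ℓ (v i ℓ)) ∧
      (∀ i x (ν : ProbabilityMeasure (BB G x i)),
        ∫ b, HH G i (lam i) (v i) x b ∂(ProbabilityMeasure.pi (φ x) : Measure (JB G x)) ≤
        ∫ b, HH G i (lam i) (v i) x b
          ∂(ProbabilityMeasure.pi (Function.update (φ x) i ν) : Measure (JB G x))) := by
  classical
  have hne : Nonempty (ZZ G C) := ⟨(fun x i => ⟨Measure.dirac (Classical.arbitrary _), inferInstance⟩,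
    fun i => ⟨_, single_mem_stdSimplex ℝ 0⟩, fun _ _ _ => ⟨0, by simpa using hC⟩)⟩
  obtain ⟨z, hz⟩ := multi_kyfan (gg G C) (continuous_gg G hA hC) (gg_zero G) (gg_loc G)
    (gg_mix G hA hC)
  refine ⟨z.1, zl z, zv z, fun i => (z.2.1 i).2, zv_abs G z, ?_, ?_, ?_⟩
  · intro i ℓ x
    set T := ∫ b, QQ G i ℓ (zv z i ℓ) x b ∂(ProbabilityMeasure.pi (z.1 x) : Measure (JB G x))
      with hT
    have hTC : |T| ≤ C := by
      refine abs_integral_le_bdd fun b => ?_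
      have := G.hp x (jval G x b)
      have h1 : |∫ y, zv z i ℓ y ∂(G.p x (jval G x b))| ≤ C :=
        abs_integral_le_bdd fun y => zv_abs G z i ℓ y
      have h2 := hb i ℓ x (jval G x b)
      have h0 := G.hα0
      have h3 := G.hα1
      unfold QQ
      refine (abs_add_le _ _).trans ?_
      rw [abs_mul, abs_mul, abs_of_pos h0, abs_of_pos (by linarith : 0 < 1 - G.α)]
      nlinarith
    have := hz (.va i ℓ x) (z.1, z.2.1, fun _ _ _ => ⟨T, abs_le.mp hTC⟩)
    simp only [gg] at this
    rw [← hT] at this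
    change (zv z i ℓ x - T) * (zv z i ℓ x - T) ≤ 0 at this
    have h0 := mul_self_eq_zero.mp (le_antisymm this (mul_self_nonneg _))
    linarith
  · intro i w hw
    have := hz (.mu i) (z.1, fun _ => ⟨w, hw⟩, z.2.2)
    simp only [gg] at this
    change ∑ ℓ, (w ℓ - zl z i ℓ) * EE G i ℓ (zv z i ℓ) ≤ 0 at this
    simp only [sub_mul, Finset.sum_sub_distrib] at this
    linarith
  · intro i x ν
    have := hz (.mn i x) (Function.update z.1 x (Function.update (z.1 x) i ν), z.2)
    simp only [gg, Function.update_self] at this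
    linarith

end Fix
end CSGame


namespace CSGame
section Final
set_option linter.unusedSectionVars false

variable {n l : ℕ}
variable {X : Type} [Countable X] [MeasurableSpace X] [DiscreteMeasurableSpace X]
variable {A : Fin n → Type} [∀ i, MeasurableSpace (A i)] [∀ i, TopologicalSpace (A i)]
  [∀ i, PolishSpace (A i)] [∀ i, BorelSpace (A i)]
variable (G : GameData n l X A)

theorem step_eq (f : X → JA A → ℝ) (hf : ∀ x, Measurable (f x)) {C : ℝ}
    (hfb : ∀ x a, |f x a| ≤ C) (u : X → ℝ) {D : ℝ} (hu : ∀ x, |u x| ≤ D) (x : X)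
    (ν : ∀ i, ProbabilityMeasure (BB G x i)) :
    ∫ b, ((1 - G.α) * f x (jval G x b) + G.α * ∫ y, u y ∂(G.p x (jval G x b)))
      ∂(ProbabilityMeasure.pi ν : Measure (JB G x)) =
    (1 - G.α) * (∫ a, f x a ∂(Measure.pi (fun i => (ν i : Measure (BB G x i)).map
      (Subtype.val : BB G x i → A i)))) +
    G.α * ∫ a, (∫ y, u y ∂(G.p x a)) ∂(Measure.pi (fun i => (ν i : Measure (BB G x i)).map
      (Subtype.val : BB G x i → A i))) := by
  have hm : Measurable fun a => ∫ y, u y ∂(G.p x a) :=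
    (StronglyMeasurable.integral_kernel (κ := ⟨G.p x, measurable_p G x⟩)
      (Measurable.of_discrete (f := u)).stronglyMeasurable).measurable
  have := G.hp x
  rw [integral_pi_map G x ν (f x) (hf x), integral_pi_map G x ν _ hm, integral_add,
    integral_const_mul, integral_const_mul]
  · exact (integrable_bdd ((hf x).comp (measurable_jval G x)) fun b => hfb x _).const_mul _
  · exact (integrable_bdd (hm.comp (measurable_jval G x))
      fun b => abs_integral_le_bdd fun y => hu y).const_mul _

theorem nash_exists (hA : AssumptionA G) (hS : AssumptionC G) (hb : BoundedCosts G) :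
    ∃ φ : StatProfile G, IsNashStat G φ := by
  classical
  have := G.hη
  obtain ⟨C, hC, hCb⟩ : ∃ C : ℝ, 0 ≤ C ∧ ∀ i ℓ x a, |G.c i ℓ x a| ≤ C := by
    choose K hK using hb
    refine ⟨∑ i, ∑ ℓ, |K i ℓ|, by positivity, fun i ℓ x a => ?_⟩
    calc |G.c i ℓ x a| ≤ |K i ℓ| := (hK i ℓ x a).trans (le_abs_self _)
      _ ≤ ∑ ℓ, |K i ℓ| := Finset.single_le_sum (f := fun ℓ => |K i ℓ|)
          (fun _ _ => abs_nonneg _) (Finset.mem_univ ℓ)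
      _ ≤ _ := Finset.single_le_sum (f := fun i => ∑ ℓ, |K i ℓ|)
          (fun _ _ => by positivity) (Finset.mem_univ i)
  obtain ⟨φ, lam, v, hlam, hvC, hv, hmu, hmn⟩ := exists_fix G hA hC hCb
  have hJ : ∀ i ℓ, J G i ℓ (ofStatAll G (toStat G φ)) = ∫ x, v i ℓ x ∂G.η := by
    intro i ℓ
    refine verif_eq G G.η _ (G.hc i ℓ) (hCb i ℓ) (v i ℓ) (hvC i ℓ) fun t h => ?_
    rw [hv i ℓ, jointLaw_toStat]
    exact step_eq G (G.c i ℓ) (G.hc i ℓ) (hCb i ℓ) (v i ℓ) (hvC i ℓ) _ _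
  -- the Lagrangian inequality
  have hlag : ∀ i (σ : Strategy G i),
      ∑ ℓ, lam i ℓ * J G i ℓ (ofStatAll G (toStat G φ)) ≤
      ∑ ℓ, lam i ℓ * J G i ℓ (combine G (ofStatAll G (toStat G φ)) i σ) := by
    intro i σ
    have h1 := Jfun_sum G G.η (combine G (ofStatAll G (toStat G φ)) i σ) (lam i) (G.c i)
      (G.hc i) (hCb i)
    have hfm : ∀ x, Measurable fun a => ∑ ℓ, lam i ℓ * G.c i ℓ x a := fun x =>
      Finset.measurable_sum _ fun ℓ _ => (G.hc i ℓ x).const_mul _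
    have hbd : ∀ r : Fin (l + 1) → ℝ, (∀ ℓ, |r ℓ| ≤ C) → |∑ ℓ, lam i ℓ * r ℓ| ≤ C := by
      intro r hr
      refine (Finset.abs_sum_le_sum_abs _ _).trans ?_
      calc ∑ ℓ, |lam i ℓ * r ℓ| ≤ ∑ ℓ, lam i ℓ * C := Finset.sum_le_sum fun ℓ _ => by
            rw [abs_mul, abs_of_nonneg ((hlam i).1 ℓ)]
            exact mul_le_mul_of_nonneg_left (hr ℓ) ((hlam i).1 ℓ)
        _ = C := by rw [← Finset.sum_mul, (hlam i).2, one_mul]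
    have hvint : ∀ (μ : Measure X) [IsProbabilityMeasure μ],
        ∫ y, ∑ ℓ, lam i ℓ * v i ℓ y ∂μ = ∑ ℓ, lam i ℓ * ∫ y, v i ℓ y ∂μ := by
      intro μ _
      rw [integral_finsetSum]
      · simp only [integral_const_mul]
      · exact fun ℓ _ => (integrable_bdd Measurable.of_discrete (hvC i ℓ)).const_mul _
    have hHH : ∀ x b, HH G i (lam i) (v i) x b =
        (1 - G.α) * (∑ ℓ, lam i ℓ * G.c i ℓ x (jval G x b)) +
        G.α * ∫ y, ∑ ℓ, lam i ℓ * v i ℓ y ∂(G.p x (jval G x b)) := by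
      intro x b
      have := G.hp x (jval G x b)
      rw [hvint, Finset.mul_sum, Finset.mul_sum, ← Finset.sum_add_distrib]
      exact Finset.sum_congr rfl fun ℓ _ => by unfold QQ; ring
    have hux : ∀ x, ∑ ℓ, lam i ℓ * v i ℓ x =
        ∫ b, HH G i (lam i) (v i) x b ∂(ProbabilityMeasure.pi (φ x) : Measure (JB G x)) := by
      intro x
      simp only [HH]
      rw [integral_finsetSum]
      · refine Finset.sum_congr rfl fun ℓ _ => ?_
        rw [integral_const_mul, ← hv i ℓ x]
      · intro ℓ _
        refine Integrable.const_mul ?_ _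
        have hz : Continuous fun b => QQ G i ℓ (v i ℓ) x b := by
          have h := continuous_pint G hA x (fun (_ : Unit) => v i ℓ)
            (fun y => continuous_const) hC (fun _ y => hvC i ℓ y)
          exact (continuous_const.mul (continuous_c G hA i ℓ x)).add
            (continuous_const.mul (h.comp (Continuous.prodMk_right ())))
        exact (BoundedContinuousFunction.mkOfCompact ⟨_, hz⟩).integrable _
    have h2 := verif G G.η (combine G (ofStatAll G (toStat G φ)) i σ)
      (f := fun x a => ∑ ℓ, lam i ℓ * G.c i ℓ x a) hfm
      (fun x a => hbd _ fun ℓ => hCb i ℓ x a) (fun x => ∑ ℓ, lam i ℓ * v i ℓ x)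
      (fun x => hbd _ fun ℓ => hvC i ℓ x) (by
        intro t h
        obtain ⟨ν, hν⟩ := jointLaw_combine G φ i σ t h
        rw [hν]
        have h3 := hmn i (lastState X (JA A) t h) ν
        rw [← hux] at h3
        refine h3.trans (le_of_eq ?_)
        simp only [hHH]
        exact step_eq G (fun x a => ∑ ℓ, lam i ℓ * G.c i ℓ x a) hfm
          (fun x a => hbd _ fun ℓ => hCb i ℓ x a) (fun x => ∑ ℓ, lam i ℓ * v i ℓ x)
          (fun x => hbd _ fun ℓ => hvC i ℓ x) _ _)
    rw [h1, hvint] at h2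
    simp only [hJ]
    exact h2
  -- consequences
  have hkey : ∀ i, Feas G i (ofStatAll G (toStat G φ)) ∧ 0 < lam i 0 ∧
      ∑ ℓ, lam i ℓ * EE G i ℓ (v i ℓ) = 0 := by
    intro i
    set V := ∑ ℓ, lam i ℓ * EE G i ℓ (v i ℓ) with hV
    have hE : ∀ ℓ, EE G i ℓ (v i ℓ) ≤ V := by
      intro ℓ
      have := hmu i _ (single_mem_stdSimplex ℝ ℓ)
      simpa [Pi.single_apply] using this
    have hE0 : EE G i 0 (v i 0) = 0 := by simp [EE]
    have hV0 : 0 ≤ V := hE0 ▸ hE 0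
    have hl0 : 0 < lam i 0 := by
      rcases ((hlam i).1 0).lt_or_eq with h | h
      · exact h
      exfalso
      obtain ⟨σ, hσ⟩ := hS (toStat G φ) i
      have h1 := hlag i σ
      have h2 : V = ∑ ℓ, lam i ℓ * (J G i ℓ (ofStatAll G (toStat G φ)) - G.κ i ℓ) := by
        rw [hV]
        refine Finset.sum_congr rfl fun ℓ _ => ?_
        by_cases hl : ℓ = 0
        · subst hl; rw [← h]; simp
        · simp [EE, hl, hJ]
      have h3 : ∑ ℓ, lam i ℓ * (J G i ℓ (combine G (ofStatAll G (toStat G φ)) i σ) - G.κ i ℓ)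
          < 0 := by
        obtain ⟨ℓ0, hℓ0⟩ : ∃ ℓ, 0 < lam i ℓ := by
          by_contra! hcon
          have : ∑ ℓ, lam i ℓ ≤ 0 := Finset.sum_nonpos fun ℓ _ => hcon ℓ
          rw [(hlam i).2] at this
          linarith
        have hne : ℓ0 ≠ 0 := by rintro rfl; rw [← h] at hℓ0; exact lt_irrefl _ hℓ0
        refine Finset.sum_neg' (fun ℓ _ => ?_) ⟨ℓ0, Finset.mem_univ _, ?_⟩
        · by_cases hl : ℓ = 0
          · subst hl; rw [← h]; simp
          · exact mul_nonpos_of_nonneg_of_nonpos ((hlam i).1 ℓ) (sub_neg.mpr (hσ ℓ hl)).le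
        · exact mul_neg_of_pos_of_neg hℓ0 (sub_neg.mpr (hσ ℓ0 hne))
      simp only [mul_sub, Finset.sum_sub_distrib] at h2 h3
      linarith
    have hVz : V = 0 := by
      have h1 : V ≤ ∑ ℓ, (lam i ℓ * V - if ℓ = 0 then lam i 0 * V else 0) := by
        rw [hV]
        refine Finset.sum_le_sum fun ℓ _ => ?_
        by_cases hl : ℓ = 0
        · subst hl; simp [hE0]
        · simp only [hl, if_false, sub_zero]
          exact mul_le_mul_of_nonneg_left (hE ℓ) ((hlam i).1 ℓ)
      rw [Finset.sum_sub_distrib, ← Finset.sum_mul, (hlam i).2] at h1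
      simp at h1
      nlinarith
    refine ⟨fun ℓ hl => ?_, hl0, hVz⟩
    have := hE ℓ
    rw [hVz] at this
    simp only [EE, hl, if_false] at this
    rw [hJ]; linarith
  refine ⟨toStat G φ, fun i => (hkey i).1, fun i σ hσ => ?_⟩
  obtain ⟨-, hl0, hVz⟩ := hkey i
  have h1 := hlag i σ
  have h2 : ∑ ℓ, lam i ℓ * EE G i ℓ (v i ℓ) =
      (∑ ℓ, lam i ℓ * J G i ℓ (ofStatAll G (toStat G φ))) -
      lam i 0 * J G i 0 (ofStatAll G (toStat G φ)) -
      ∑ k : Fin l, lam i k.succ * G.κ i k.succ := by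
    rw [Fin.sum_univ_succ, Fin.sum_univ_succ]
    simp [EE, hJ, mul_sub, Finset.sum_sub_distrib, Fin.succ_ne_zero]
  have h3 : ∑ k : Fin l, lam i k.succ *
        J G i k.succ (combine G (ofStatAll G (toStat G φ)) i σ) ≤
      ∑ k : Fin l, lam i k.succ * G.κ i k.succ :=
    Finset.sum_le_sum fun k _ =>
      mul_le_mul_of_nonneg_left (hσ _ (Fin.succ_ne_zero k)) ((hlam i).1 _)
  rw [Fin.sum_univ_succ (f := fun ℓ => lam i ℓ *
    J G i ℓ (combine G (ofStatAll G (toStat G φ)) i σ))] at h1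
  have h4 : lam i 0 * J G i 0 (ofStatAll G (toStat G φ)) ≤
      lam i 0 * J G i 0 (combine G (ofStatAll G (toStat G φ)) i σ) := by linarith
  exact le_of_mul_le_mul_left h4 hl0

end Final
end CSGame


open CSGame

namespace CSGame

variable {n l : ℕ}
variable {X : Type} [Countable X] [MeasurableSpace X] [DiscreteMeasurableSpace X]
  [TopologicalSpace X] [DiscreteTopology X] [BorelSpace X] [SecondCountableTopology X]
variable {A : Fin n → Type} [∀ i, MeasurableSpace (A i)] [∀ i, TopologicalSpace (A i)]
  [∀ i, PolishSpace (A i)] [∀ i, BorelSpace (A i)]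
variable (G : GameData n l X A)

/-- Corollary 2. -/
theorem stmt2 (hA : AssumptionA G) (hC : AssumptionC G) (hb : BoundedCosts G) :
    ∃ φ : StatProfile G, IsNashStat G φ := by
  exact nash_exists G hA hC hb


end CSGame
end

section
/- Under Assumption A(i) (the map a ↦ p(y|x,a) is continuous on A(x) for all x,y ∈ X), the set M of all occupation measures induced by correlated strategies and the initial distribution η is convex and compact in Pr(K) equipped with the weak topology. -/
open MeasureTheory ProbabilityTheory Filter Topology
open scoped ENNReal NNReal

open CSGame

namespace CSGame

variable {n l : ℕ}
variable {X : Type} [Countable X] [MeasurableSpace X] [DiscreteMeasurableSpace X]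
  [TopologicalSpace X] [DiscreteTopology X] [BorelSpace X] [SecondCountableTopology X]
variable {A : Fin n → Type} [∀ i, MeasurableSpace (A i)] [∀ i, TopologicalSpace (A i)]
  [∀ i, PolishSpace (A i)] [∀ i, BorelSpace (A i)]
variable (G : GameData n l X A)

set_option linter.unusedSectionVars false

theorem measurable_p_s4 : Measurable fun q : X × JA A => G.p q.1 q.2 := by
  refine measurable_from_prod_countable_right fun x => ?_
  refine Measure.measurable_of_measurable_coe _ fun s _ => ?_
  have : (fun a => G.p x a s) = fun a => ∑' y : s, G.p x a {(y : X)} := by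
    funext a
    rw [← Measure.tsum_indicator_apply_singleton _ s (MeasurableSet.of_discrete), tsum_subtype s (fun y => G.p x a {y})]
  show Measurable (fun a => G.p x a s)
  rw [this]
  exact Measurable.tsum fun y => G.hpm x y

/-- The transition kernel. -/
noncomputable def pK : Kernel (X × JA A) X := ⟨fun q => G.p q.1 q.2, measurable_p_s4 G⟩

theorem pK_apply (q : X × JA A) : pK G q = G.p q.1 q.2 := rfl

instance : IsMarkovKernel (pK G) := ⟨fun q => G.hp q.1 q.2⟩

/-- The strategy kernel. -/
noncomputable def fK (π : CorrStrategy G) (t : ℕ) : Kernel (Hist X (JA A) t) (JA A) :=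
  ⟨fun h => (π.f t h : Measure (JA A)), Measure.measurable_of_measurable_coe _ fun s hs => π.meas t s hs⟩

theorem fK_apply (π : CorrStrategy G) (t : ℕ) (h : Hist X (JA A) t) :
    fK G π t h = (π.f t h : Measure (JA A)) := rfl

instance (π : CorrStrategy G) (t : ℕ) : IsMarkovKernel (fK G π t) :=
  ⟨fun h => by rw [fK_apply]; infer_instance⟩

/-- law of the stage state-action pair -/
noncomputable def st (π : CorrStrategy G) (t : ℕ) : Measure (X × JA A) :=
  (histMeasC G π t).bind fun h =>
        (π.f t h : Measure (JA A)).map fun a => (lastState X (JA A) t h, a)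

theorem occ_eq (π : CorrStrategy G) : occ G π = ENNReal.ofReal (1 - G.α) •
    Measure.sum fun t : ℕ => ENNReal.ofReal G.α ^ t • st G π t := rfl

theorem lintegral_st (π : CorrStrategy G) (t : ℕ) (g : X × JA A → ℝ≥0∞) (hg : Measurable g) :
    ∫⁻ q, g q ∂(st G π t) =
      ∫⁻ h, ∫⁻ a, g (lastState X (JA A) t h, a) ∂(π.f t h : Measure (JA A)) ∂(histMeasC G π t) := by
  have hl := measurable_lastState X (JA A) t
  rw [st, Measure.lintegral_bind _ hg.aemeasurable]
  · refine lintegral_congr fun h => ?_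
    rw [lintegral_map hg (by fun_prop)]
  · refine Measurable.aemeasurable (Measure.measurable_of_measurable_coe _ fun s hs => ?_)
    have : ∀ h, ((π.f t h : Measure (JA A)).map fun a => (lastState X (JA A) t h, a)) s
        = fK G π t h (Prod.mk h ⁻¹' {z | (lastState X (JA A) t z.1, z.2) ∈ s}) := by
      intro h
      rw [Measure.map_apply (by fun_prop) hs]; rfl
    simp_rw [this]
    refine Kernel.measurable_kernel_prodMk_left ?_
    exact (show Measurable (fun z : Hist X (JA A) t × JA A =>
      (lastState X (JA A) t z.1, z.2)) by fun_prop) hs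

theorem lintegral_hist_succ (π : CorrStrategy G) (t : ℕ) (g : Hist X (JA A) (t+1) → ℝ≥0∞)
    (hg : Measurable g) :
    ∫⁻ h, g h ∂(histMeasC G π (t+1)) =
      ∫⁻ h, ∫⁻ a, ∫⁻ y, g (show Hist X (JA A) (t + 1) from (h, a, y))
        ∂(G.p (lastState X (JA A) t h) a) ∂(π.f t h : Measure (JA A)) ∂(histMeasC G π t) := by
  have hl := measurable_lastState X (JA A) t
  let P : Kernel (Hist X (JA A) t × JA A) X :=
    (pK G).comap (fun z => (lastState X (JA A) t z.1, z.2)) (by fun_prop)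
  have hP : ∀ h a, P (h, a) = G.p (lastState X (JA A) t h) a := fun h a => rfl
  have e : ∀ h : Hist X (JA A) t, Measurable (fun z : JA A × X =>
      (show Hist X (JA A) (t + 1) from (h, z.1, z.2))) := fun h =>
    (measurable_const.prodMk (measurable_fst.prodMk measurable_snd) : Measurable (fun z : JA A × X => (h, z.1, z.2)))
  have e' : Measurable (fun z : (Hist X (JA A) t × JA A) × X =>
      (show Hist X (JA A) (t + 1) from (z.1.1, z.1.2, z.2))) := 
    (by fun_prop : Measurable (fun z : (Hist X (JA A) t × JA A) × X => (z.1.1, z.1.2, z.2)))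
  have e1 : ∀ h a, Measurable (fun y : X => (show Hist X (JA A) (t + 1) from (h, a, y))) :=
    fun h a => (e h).comp measurable_prodMk_left
  have m0 : Measurable fun z : Hist X (JA A) t × JA A =>
      (G.p (lastState X (JA A) t z.1) z.2).map fun y =>
            (show Hist X (JA A) (t + 1) from (z.1, z.2, y)) := by
    refine Measure.measurable_of_measurable_coe _ fun s hs => ?_
    have : ∀ z : Hist X (JA A) t × JA A, ((G.p (lastState X (JA A) t z.1) z.2).map fun y =>
            (show Hist X (JA A) (t + 1) from (z.1, z.2, y))) s = 
            P z (Prod.mk z ⁻¹' ((fun z : (Hist X (JA A) t × JA A) × X =>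
      (show Hist X (JA A) (t + 1) from (z.1.1, z.1.2, z.2))) ⁻¹' s)) := by
      intro z
      rw [Measure.map_apply (e1 _ _) hs]; rfl
    simp_rw [this]
    exact Kernel.measurable_kernel_prodMk_left (e' hs)
  have m1 : ∀ h, Measurable fun a => (G.p (lastState X (JA A) t h) a).map fun y =>
            (show Hist X (JA A) (t + 1) from (h, a, y)) := fun h => m0.comp measurable_prodMk_left
  rw [histMeasC, Measure.lintegral_bind _ hg.aemeasurable]
  · refine lintegral_congr fun h => ?_
    rw [Measure.lintegral_bind (m1 h).aemeasurable hg.aemeasurable]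
    refine lintegral_congr fun a => ?_
    rw [lintegral_map hg (e1 h a)]
  · refine Measurable.aemeasurable (Measure.measurable_of_measurable_coe _ fun s hs => ?_)
    have : ∀ h, ((π.f t h : Measure (JA A)).bind fun a =>
          (G.p (lastState X (JA A) t h) a).map fun y =>
            (show Hist X (JA A) (t + 1) from (h, a, y))) s
        = ∫⁻ a, ((G.p (lastState X (JA A) t h) a).map fun y =>
            (show Hist X (JA A) (t + 1) from (h, a, y))) s ∂(fK G π t h) := by
      intro h
      rw [Measure.bind_apply hs (m1 h).aemeasurable]; rfl
    simp_rw [this]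
    exact Measurable.lintegral_kernel_prod_right ((Measure.measurable_coe hs).comp m0)

/-- law of the stage state -/
theorem lintegral_hist_zero (π : CorrStrategy G) (F : X → ℝ≥0∞) :
    ∫⁻ h, F (lastState X (JA A) 0 h) ∂(histMeasC G π 0) = ∫⁻ x, F x ∂G.η := rfl

theorem lintegral_hist_last_succ (π : CorrStrategy G) (t : ℕ) (F : X → ℝ≥0∞) :
    ∫⁻ h, F (lastState X (JA A) (t+1) h) ∂(histMeasC G π (t+1)) =
      ∫⁻ q, ∫⁻ y, F y ∂(G.p q.1 q.2) ∂(st G π t) := by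
  have hF : Measurable F := Measurable.of_discrete
  have h1 := lintegral_hist_succ G π t _ (hF.comp (measurable_lastState X (JA A) (t+1)))
  simp only [Function.comp_def] at h1
  rw [h1, lintegral_st]
  · rfl
  · exact (hF.comp measurable_snd).lintegral_kernel_prod_right' (κ := pK G)

theorem lintegral_st_fst (π : CorrStrategy G) (t : ℕ) (F : X → ℝ≥0∞) :
    ∫⁻ q, F q.1 ∂(st G π t) = ∫⁻ h, F (lastState X (JA A) t h) ∂(histMeasC G π t) := by
  have hF : Measurable F := Measurable.of_discrete
  have h1 := lintegral_st G π t _ (hF.comp measurable_fst)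
  simp only [Function.comp_def] at h1
  rw [h1]
  simp

theorem lintegral_occ (π : CorrStrategy G) (g : X × JA A → ℝ≥0∞) :
    ∫⁻ q, g q ∂(occ G π) = ENNReal.ofReal (1 - G.α) * 
      ∑' t : ℕ, ENNReal.ofReal G.α ^ t * ∫⁻ q, g q ∂(st G π t) := by
  rw [occ_eq, lintegral_smul_measure, lintegral_sum_measure]
  simp only [lintegral_smul_measure, smul_eq_mul]

/-- balance equation -/
def Bal (ρ : Measure (X × JA A)) : Prop :=
  ∀ F : X → ℝ≥0∞, ∫⁻ q, F q.1 ∂ρ = ENNReal.ofReal (1 - G.α) * ∫⁻ x, F x ∂G.η +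
    ENNReal.ofReal G.α * ∫⁻ q, ∫⁻ y, F y ∂(G.p q.1 q.2) ∂ρ

/-- the graph of feasible pairs -/
def KK : Set (X × JA A) := {q | q.2 ∈ jointSet G q.1}

theorem bal_occ (π : CorrStrategy G) : Bal G (occ G π) := by
  intro F
  rw [lintegral_occ, lintegral_occ, tsum_eq_zero_add' ENNReal.summable, mul_add]
  congr 1
  · rw [lintegral_st_fst, lintegral_hist_zero]; simp
  · rw [mul_left_comm]
    congr 1
    rw [← ENNReal.tsum_mul_left]
    congr 1; funext t
    rw [lintegral_st_fst, lintegral_hist_last_succ, pow_succ']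
    ring

theorem occ_prob (π : CorrStrategy G) : IsProbabilityMeasure (occ G π) := by
  have h1 : ∀ t, histMeasC G π t Set.univ = 1 := by
    intro t
    induction t with
    | zero => exact G.hη.measure_univ
    | succ t ih =>
      rw [← lintegral_one, lintegral_hist_succ G π t _ measurable_const]
      have := fun x a => G.hp x a
      simp [ih]
  constructor
  rw [← lintegral_one, lintegral_occ]
  have : ∀ t, ∫⁻ q, 1 ∂(st G π t) = 1 := by
    intro t
    rw [lintegral_st_fst G π t (fun _ => 1)]
    simp [h1]
  simp only [this, mul_one, ENNReal.tsum_geometric]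
  have h0 := G.hα0
  have h1 := G.hα1
  rw [show (1 : ℝ≥0∞) - ENNReal.ofReal G.α = ENNReal.ofReal (1 - G.α) by
    rw [ENNReal.ofReal_sub _ h0.le, ENNReal.ofReal_one]]
  refine ENNReal.mul_inv_cancel ?_ ENNReal.ofReal_ne_top
  simp [h1]

theorem jointSet_compact (x : X) : IsCompact (jointSet G x) :=
  isCompact_univ_pi fun i => G.hAs_cpt i x

theorem isClosed_KK : IsClosed (KK G) := by
  rw [← isOpen_compl_iff]
  have : (KK G)ᶜ = ⋃ x : X, ({x} : Set X) ×ˢ (jointSet G x)ᶜ := by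
    ext ⟨x, a⟩; simp [KK]
  rw [this]
  exact isOpen_iUnion fun x => (isOpen_discrete _).prod (jointSet_compact G x).isClosed.isOpen_compl

theorem supp_occ (π : CorrStrategy G) : occ G π (KK G)ᶜ = 0 := by
  have hm : MeasurableSet (KK G)ᶜ := (isClosed_KK G).measurableSet.compl
  rw [← lintegral_indicator_one hm, lintegral_occ]
  have : ∀ t, ∫⁻ q, (KK G)ᶜ.indicator 1 q ∂(st G π t) = 0 := by
    intro t
    rw [lintegral_st _ _ _ _ (measurable_one.indicator hm)]
    rw [← lintegral_zero]
    refine lintegral_congr fun h => ?_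
    have hj := (jointSet_compact G (lastState X (JA A) t h)).isClosed.measurableSet
    rw [show (fun a => (KK G)ᶜ.indicator (1 : X × JA A → ℝ≥0∞) (lastState X (JA A) t h, a)) =
      (jointSet G (lastState X (JA A) t h))ᶜ.indicator 1 from rfl, lintegral_indicator_one hj.compl]
    rw [prob_compl_eq_zero_iff hj]
    have := π.supp t h
    rw [← ProbabilityMeasure.ennreal_coeFn_eq_coeFn_toMeasure, this]; rfl
  simp [this]

/-- bundling -/
def mkP {Ω : Type} [MeasurableSpace Ω] (μ : Measure Ω) (h : IsProbabilityMeasure μ) :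
    ProbabilityMeasure Ω := ⟨μ, h⟩

theorem coe_mkP {Ω : Type} [MeasurableSpace Ω] (μ : Measure Ω) (h : IsProbabilityMeasure μ) :
    (mkP μ h : Measure Ω) = μ := rfl

theorem exists_kernel (ρ : Measure (X × JA A)) [IsProbabilityMeasure ρ] (hs : ρ (KK G)ᶜ = 0) :
    ∃ φ : X → ProbabilityMeasure (JA A), (∀ x, φ x (jointSet G x) = 1) ∧
      ∀ g : X × JA A → ℝ≥0∞, Measurable g →
        ∫⁻ q, g q ∂ρ = ∫⁻ q, ∫⁻ a, g (q.1, a) ∂(φ q.1 : Measure (JA A)) ∂ρ := by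
  classical
  have hne : ∀ x, (jointSet G x).Nonempty := fun x => Set.univ_pi_nonempty_iff.2 fun i => G.hAs_ne i x
  obtain ⟨q0⟩ : Nonempty (X × JA A) := ρ.nonempty_of_neZero
  have : Nonempty (JA A) := ⟨q0.2⟩
  choose d hd using hne
  have hm : ∀ x, MeasurableSet (jointSet G x) := fun x => (jointSet_compact G x).isClosed.measurableSet
  let κ := ρ.condKernel
  have hex : ∀ x, ∃ μ : ProbabilityMeasure (JA A), (μ : Measure (JA A)) (jointSet G x) = 1 ∧
      (κ x (jointSet G x) = 1 → (μ : Measure (JA A)) = κ x) := by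
    intro x
    by_cases hx : κ x (jointSet G x) = 1
    · exact ⟨mkP (κ x) inferInstance, hx, fun _ => rfl⟩
    · refine ⟨mkP (Measure.dirac (d x)) inferInstance, ?_, fun h => absurd h hx⟩
      show Measure.dirac (d x) (jointSet G x) = _
      rw [Measure.dirac_apply' _ (hm x)]
      simp [hd x]
  choose φ hφ1 hφ using hex
  have hdis : ρ.fst ⊗ₘ κ = ρ := ρ.disintegrate κ
  have hae : ∀ᵐ x ∂ρ.fst, κ x (jointSet G x) = 1 := by
    have h1 : ∀ᵐ q ∂(ρ.fst ⊗ₘ κ), q ∈ KK G := by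
      rw [hdis]; exact hs
    filter_upwards [Measure.ae_ae_of_ae_compProd h1] with x hx
    exact (prob_compl_eq_zero_iff (hm x)).1 hx
  refine ⟨φ, fun x => ?_, fun g hg => ?_⟩
  · rw [← ENNReal.coe_inj, ProbabilityMeasure.ennreal_coeFn_eq_coeFn_toMeasure]
    rw [hφ1]; rfl
  · have hF : Measurable fun x => ∫⁻ a, g (x, a) ∂(φ x : Measure (JA A)) := Measurable.of_discrete
    calc ∫⁻ q, g q ∂ρ = ∫⁻ q, g q ∂(ρ.fst ⊗ₘ κ) := by rw [hdis]
      _ = ∫⁻ x, ∫⁻ a, g (x, a) ∂(κ x) ∂ρ.fst := Measure.lintegral_compProd hg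
      _ = ∫⁻ x, ∫⁻ a, g (x, a) ∂(φ x : Measure (JA A)) ∂ρ.fst := by
        refine lintegral_congr_ae ?_
        filter_upwards [hae] with x hx
        rw [hφ x hx]
      _ = _ := by rw [Measure.fst, lintegral_map hF measurable_fst]

theorem mem_of_bal (ρ : Measure (X × JA A)) [IsProbabilityMeasure ρ] (hs : ρ (KK G)ᶜ = 0)
    (hb : Bal G ρ) : ∃ π : CorrStrategy G, ρ = occ G π := by
  obtain ⟨φ, hφ1, hφ⟩ := exists_kernel G ρ hs
  let π : CorrStrategy G :=
    { f := fun t h => φ (lastState X (JA A) t h)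
      meas := fun t s _ => (Measurable.of_discrete (f := fun x => (φ x : Measure (JA A)) s)).comp
        (measurable_lastState X (JA A) t)
      supp := fun t h => hφ1 _ }
  have hst : ∀ t (g : X × JA A → ℝ≥0∞), Measurable g → ∫⁻ q, g q ∂(st G π t) =
      ∫⁻ h, (fun x => ∫⁻ a, g (x, a) ∂(φ x : Measure (JA A))) (lastState X (JA A) t h)
        ∂(histMeasC G π t) := fun t g hg => lintegral_st G π t g hg
  have hpm : ∀ F : X → ℝ≥0∞, Measurable fun q : X × JA A => ∫⁻ y, F y ∂(G.p q.1 q.2) := fun F =>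
    ((Measurable.of_discrete (f := F)).comp measurable_snd).lintegral_kernel_prod_right' (κ := pK G)
  have key : ∀ (T : ℕ) (F : X → ℝ≥0∞), ∑ t ∈ Finset.range T, ENNReal.ofReal (1 - G.α) *
      (ENNReal.ofReal G.α ^ t * ∫⁻ h, F (lastState X (JA A) t h) ∂(histMeasC G π t)) ≤
        ∫⁻ q, F q.1 ∂ρ := by
    intro T
    induction T with
    | zero => intro F; simp
    | succ T ih =>
      intro F
      rw [hb F, Finset.sum_range_succ', add_comm]
      gcongr
      · simp [lintegral_hist_zero]
      · rw [hφ _ (hpm F)]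
        refine le_trans (le_of_eq ?_) (mul_le_mul_right
          (ih fun x => ∫⁻ a, ∫⁻ y, F y ∂(G.p x a) ∂(φ x : Measure (JA A))) _)
        rw [Finset.mul_sum]
        refine Finset.sum_congr rfl fun t _ => ?_
        rw [lintegral_hist_last_succ, hst _ _ (hpm F), pow_succ']
        ring
  have := occ_prob G π
  refine ⟨π, (Measure.eq_of_le_of_isProbabilityMeasure ?_).symm⟩
  refine Measure.le_iff.2 fun s hs => ?_
  have hg : Measurable (s.indicator (1 : X × JA A → ℝ≥0∞)) := measurable_one.indicator hs
  rw [← lintegral_indicator_one hs, ← lintegral_indicator_one hs, lintegral_occ,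
    ← ENNReal.tsum_mul_left, hφ _ hg]
  refine ENNReal.tsum_le_of_sum_range_le fun T => ?_
  refine le_trans (le_of_eq ?_) 
    (key T fun x => ∫⁻ a, s.indicator 1 (x, a) ∂(φ x : Measure (JA A)))
  refine Finset.sum_congr rfl fun t _ => ?_
  rw [hst t _ hg]

theorem mem_OccSet_iff (ρ : ProbabilityMeasure (X × JA A)) :
    ρ ∈ OccSet G ↔ (ρ : Measure (X × JA A)) (KK G)ᶜ = 0 ∧ Bal G ρ := by
  constructor
  · rintro ⟨π, h⟩
    rw [h]
    exact ⟨supp_occ G π, bal_occ G π⟩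
  · rintro ⟨h1, h2⟩
    exact mem_of_bal G _ h1 h2

theorem occ_convex : ∀ ρ₁ ∈ OccSet G, ∀ ρ₂ ∈ OccSet G, ∀ θ : ℝ, 0 ≤ θ → θ ≤ 1 →
      ∃ ρ ∈ OccSet G, (ρ : Measure (X × JA A)) =
        ENNReal.ofReal θ • (ρ₁ : Measure (X × JA A)) +
          ENNReal.ofReal (1 - θ) • (ρ₂ : Measure (X × JA A)) := by
  intro ρ₁ h₁ ρ₂ h₂ θ h0 h1
  rw [mem_OccSet_iff] at h₁ h₂
  have hsum : ENNReal.ofReal θ + ENNReal.ofReal (1 - θ) = 1 := by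
    rw [← ENNReal.ofReal_add h0 (by linarith)]; simp
  have hP : IsProbabilityMeasure (ENNReal.ofReal θ • (ρ₁ : Measure (X × JA A)) +
          ENNReal.ofReal (1 - θ) • (ρ₂ : Measure (X × JA A))) := by
    constructor
    simp [hsum]
  refine ⟨mkP _ hP, ?_, rfl⟩
  rw [mem_OccSet_iff]
  simp only [coe_mkP]
  constructor
  · simp [h₁.1, h₂.1]
  · intro F
    simp only [lintegral_add_measure, lintegral_smul_measure, smul_eq_mul]
    rw [h₁.2 F, h₂.2 F]
    calc _ = (ENNReal.ofReal θ + ENNReal.ofReal (1 - θ)) *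
          (ENNReal.ofReal (1 - G.α) * ∫⁻ x, F x ∂G.η) + ENNReal.ofReal G.α *
          (ENNReal.ofReal θ * ∫⁻ q, ∫⁻ y, F y ∂(G.p q.1 q.2) ∂(ρ₁ : Measure (X × JA A)) +
           ENNReal.ofReal (1 - θ) * ∫⁻ q, ∫⁻ y, F y ∂(G.p q.1 q.2) ∂(ρ₂ : Measure (X × JA A))) := by ring
      _ = _ := by rw [hsum, one_mul]

theorem exists_finset (μ : Measure X) [IsProbabilityMeasure μ] {ε : ℝ≥0∞} (hε : 0 < ε) :
    ∃ V : Finset X, 1 - ε < ∑ y ∈ V, μ {y} := by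
  have h : 1 - ε < ∑' y, μ {y} := by
    have : ∑' y, μ {y} = 1 := by
      rw [← measure_univ (μ := μ), ← Measure.tsum_indicator_apply_singleton _ _ MeasurableSet.univ]
      simp
    rw [this]
    exact ENNReal.sub_lt_self ENNReal.one_ne_top one_ne_zero hε.ne'
  rw [ENNReal.tsum_eq_iSup_sum] at h
  exact lt_iSup_iff.1 h

theorem compl_le (μ : Measure X) [IsProbabilityMeasure μ] {ε : ℝ≥0∞} (V : Finset X)
    (h : 1 - ε ≤ ∑ y ∈ V, μ {y}) : μ (V : Set X)ᶜ ≤ ε := by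
  rw [prob_compl_eq_one_sub MeasurableSet.of_discrete, ← sum_measure_singleton]
  rw [tsub_le_iff_right] at h ⊢
  rwa [add_comm]

theorem exists_finset_unif (hA1 : AssumptionA1 G) {ε : ℝ≥0∞} (hε : 0 < ε) (x : X) :
    ∃ V : Finset X, ∀ a ∈ jointSet G x, G.p x a (V : Set X)ᶜ ≤ ε := by
  classical
  refine (jointSet_compact G x).induction_on
    (p := fun s => ∃ V : Finset X, ∀ a ∈ s, G.p x a (V : Set X)ᶜ ≤ ε) ⟨∅, by simp⟩ ?_ ?_ ?_
  · rintro s t hst ⟨V, hV⟩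
    exact ⟨V, fun a ha => hV a (hst ha)⟩
  · rintro s t ⟨V, hV⟩ ⟨W, hW⟩
    refine ⟨V ∪ W, ?_⟩
    rintro a (ha | ha)
    · exact (measure_mono (by simp)).trans (hV a ha)
    · exact (measure_mono (by simp)).trans (hW a ha)
  · intro a ha
    have := G.hp x a
    obtain ⟨V, hV⟩ := exists_finset (G.p x a) hε
    have hc : ContinuousWithinAt (fun a => ∑ y ∈ V, G.p x a {y}) (jointSet G x) a :=
      tendsto_finsetSum _ fun y _ => hA1 x y a ha
    refine ⟨_, hc.eventually (lt_mem_nhds hV), V, fun b hb => ?_⟩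
    have := G.hp x b
    exact compl_le _ _ (le_of_lt hb)

theorem bal_set (ρ : Measure (X × JA A)) (hb : Bal G ρ) (s : Set X) :
    ρ (Prod.fst ⁻¹' s) = ENNReal.ofReal (1 - G.α) * G.η s +
      ENNReal.ofReal G.α * ∫⁻ q, G.p q.1 q.2 s ∂ρ := by
  have h := hb (s.indicator 1)
  have hs : MeasurableSet s := MeasurableSet.of_discrete
  simp only [lintegral_indicator_one hs] at h
  rw [← h, ← lintegral_indicator_one (measurable_fst hs)]
  rfl

theorem bal_of_singleton (ρ : Measure (X × JA A)) 
    (h : ∀ y, ρ (Prod.fst ⁻¹' {y}) = ENNReal.ofReal (1 - G.α) * G.η {y} +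
      ENNReal.ofReal G.α * ∫⁻ q, G.p q.1 q.2 {y} ∂ρ) : Bal G ρ := by
  intro F
  have hF : Measurable F := Measurable.of_discrete
  have e : ρ.map Prod.fst = ENNReal.ofReal (1 - G.α) • G.η + ENNReal.ofReal G.α • ρ.bind (pK G) := by
    refine Measure.ext_of_singleton fun y => ?_
    rw [Measure.map_apply measurable_fst (MeasurableSet.singleton y), h y]
    simp only [Measure.add_apply, Measure.smul_apply, smul_eq_mul]
    rw [Measure.bind_apply (MeasurableSet.singleton y) (pK G).measurable.aemeasurable]
    rfl
  rw [← lintegral_map hF measurable_fst, e, lintegral_add_measure, lintegral_smul_measure,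
    lintegral_smul_measure, Measure.lintegral_bind (pK G).measurable.aemeasurable hF.aemeasurable]
  rfl

/-- uniform tail bound -/
def TB (c : ℝ) : Prop := ∃ V : Finset X, ∀ ρ ∈ OccSet G,
  (ρ : Measure (X × JA A)) (Prod.fst ⁻¹' (V : Set X)ᶜ) ≤ ENNReal.ofReal c

theorem TB_step (hA1 : AssumptionA1 G) {c ε : ℝ} (hc : 0 ≤ c) (hε : 0 < ε) (h : TB G c) :
    TB G (G.α * c + ε) := by
  classical
  have hε' : 0 < ENNReal.ofReal ε := by simpa
  obtain ⟨F, hF⟩ := h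
  have := G.hη
  have h0 := G.hα0
  have h1 := G.hα1
  obtain ⟨V0, hV0⟩ := exists_finset G.η hε'
  choose W hW using exists_finset_unif G hA1 hε'
  refine ⟨V0 ∪ F.biUnion W, fun ρ hρ => ?_⟩
  have hb := (mem_OccSet_iff G ρ).1 hρ
  rw [bal_set G _ hb.2]
  have e1 : G.η ((V0 ∪ F.biUnion W : Finset X) : Set X)ᶜ ≤ ENNReal.ofReal ε :=
    (measure_mono (by simp)).trans (compl_le _ V0 hV0.le)
  have e2 : ∫⁻ q, G.p q.1 q.2 ((V0 ∪ F.biUnion W : Finset X) : Set X)ᶜ ∂(ρ : Measure (X × JA A)) ≤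
      ENNReal.ofReal ε + ENNReal.ofReal c := by
    have hms : MeasurableSet (Prod.fst ⁻¹' (F : Set X)ᶜ : Set (X × JA A)) :=
      measurable_fst MeasurableSet.of_discrete
    calc _ ≤ ∫⁻ q, (ENNReal.ofReal ε + (Prod.fst ⁻¹' (F : Set X)ᶜ).indicator 1 q)
            ∂(ρ : Measure (X × JA A)) := by
          refine lintegral_mono_ae ?_
          have hk : ∀ᵐ q ∂(ρ : Measure (X × JA A)), q ∈ KK G := hb.1
          filter_upwards [hk] with q hq
          by_cases hqF : q.1 ∈ F
          · refine le_add_right ((measure_mono ?_).trans (hW q.1 q.2 hq))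
            refine Set.compl_subset_compl.2 ?_
            intro y hy
            simp only [Finset.coe_union, Finset.coe_biUnion, Set.mem_union, Set.mem_iUnion]
            exact Or.inr ⟨q.1, hqF, hy⟩
          · refine le_add_left ?_
            have := G.hp q.1 q.2
            rw [Set.indicator_of_mem (by simpa using hqF)]
            exact prob_le_one
      _ = ENNReal.ofReal ε + (ρ : Measure (X × JA A)) (Prod.fst ⁻¹' (F : Set X)ᶜ) := by
          rw [lintegral_add_left measurable_const, lintegral_indicator_one hms]
          simp
      _ ≤ _ := by gcongr; exact hF ρ hρ
  calc _ ≤ ENNReal.ofReal (1 - G.α) * ENNReal.ofReal ε +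
        ENNReal.ofReal G.α * (ENNReal.ofReal ε + ENNReal.ofReal c) := by gcongr
    _ = ENNReal.ofReal (G.α * c + ε) := by
      rw [← ENNReal.ofReal_add hε.le hc, ← ENNReal.ofReal_mul (by linarith),
        ← ENNReal.ofReal_mul h0.le, ← ENNReal.ofReal_add]
      · congr 1; ring
      · exact mul_nonneg (by linarith) hε.le
      · positivity

theorem TB_all (hA1 : AssumptionA1 G) {ε : ℝ} (hε : 0 < ε) : TB G ε := by
  have h0 := G.hα0
  have h1 := G.hα1
  let S : Set ℝ := {c | 0 ≤ c ∧ TB G c}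
  have hS : (1 : ℝ) ∈ S := ⟨zero_le_one, ∅, fun ρ _ => by simp⟩
  have hbd : BddBelow S := ⟨0, fun c hc => hc.1⟩
  have hstep : ∀ c ∈ S, sInf S ≤ G.α * c := by
    intro c hc
    refine le_of_forall_pos_le_add fun e he => csInf_le hbd ⟨?_, TB_step G hA1 hc.1 he hc.2⟩
    have := hc.1
    positivity
  have h2 : sInf S / G.α ≤ sInf S := le_csInf ⟨1, hS⟩ fun c hc => by
    rw [div_le_iff₀ h0, mul_comm]; exact hstep c hc
  rw [div_le_iff₀ h0] at h2
  have h3 : sInf S < ε := by nlinarith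
  obtain ⟨c, hc, hce⟩ := exists_lt_of_csInf_lt ⟨1, hS⟩ h3
  obtain ⟨V, hV⟩ := hc.2
  exact ⟨V, fun ρ hρ => (hV ρ hρ).trans (ENNReal.ofReal_le_ofReal hce.le)⟩

theorem occ_tight (hA1 : AssumptionA1 G) :
    IsTightMeasureSet {((μ : ProbabilityMeasure (X × JA A)) : Measure (X × JA A)) | μ ∈ OccSet G} := by
  rw [isTightMeasureSet_iff_exists_isCompact_measure_compl_le]
  intro ε hε
  obtain ⟨r, hr, hrε⟩ : ∃ r : ℝ, 0 < r ∧ ENNReal.ofReal r ≤ ε := by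
    obtain ⟨r, hr0, hr⟩ := ENNReal.lt_iff_exists_nnreal_btwn.1 hε
    refine ⟨r, NNReal.coe_pos.2 (ENNReal.coe_pos.1 hr0), ?_⟩
    rw [ENNReal.ofReal_coe_nnreal]
    exact hr.le
  obtain ⟨V, hV⟩ := TB_all G hA1 hr
  have hcpt : IsCompact (⋃ x ∈ V, ({x} : Set X) ×ˢ jointSet G x) :=
    V.isCompact_biUnion fun x _ => isCompact_singleton.prod (jointSet_compact G x)
  refine ⟨⋃ x ∈ V, ({x} : Set X) ×ˢ jointSet G x, hcpt, ?_⟩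
  intro μ hμ
  obtain ⟨ρ, hρ, rfl⟩ := hμ
  refine le_trans ?_ ((hV ρ hρ).trans hrε)
  have hb := ((mem_OccSet_iff G ρ).1 hρ).1
  have hsub : (⋃ x ∈ V, ({x} : Set X) ×ˢ jointSet G x)ᶜ ⊆
      Prod.fst ⁻¹' (V : Set X)ᶜ ∪ (KK G)ᶜ := by
    intro q h
    by_contra hc
    rw [Set.mem_union, not_or] at hc
    have h1 : q.1 ∈ V := by simpa using hc.1
    have h2 : q.2 ∈ jointSet G q.1 := not_not.1 hc.2
    refine h ?_
    exact Set.mem_biUnion (x := q.1) h1 (Set.mem_prod.2 ⟨Set.mem_singleton _, h2⟩)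
  refine (measure_mono hsub).trans ((measure_union_le _ _).trans ?_)
  rw [hb, add_zero]

theorem continuousOn_p (hA1 : AssumptionA1 G) (y : X) :
    ContinuousOn (fun q : X × JA A => G.p q.1 q.2 {y}) (KK G) := by
  rintro ⟨x, a⟩ hq
  have hn : (Prod.fst ⁻¹' {x} : Set (X × JA A)) ∈ 𝓝 (x, a) :=
    ((isOpen_discrete ({x} : Set X)).preimage continuous_fst).mem_nhds rfl
  rw [← continuousWithinAt_inter hn]
  have h1 : ContinuousWithinAt (fun q : X × JA A => G.p x q.2 {y})
      (KK G ∩ Prod.fst ⁻¹' {x}) (x, a) := by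
    refine ContinuousWithinAt.comp (t := jointSet G x) (g := fun a => G.p x a {y}) (hA1 x y a hq)
      continuous_snd.continuousWithinAt ?_
    rintro ⟨x', a'⟩ ⟨h, h'⟩
    cases h'
    exact h
  refine h1.congr ?_ rfl
  rintro ⟨x', a'⟩ ⟨h, h'⟩
  cases h'
  rfl

theorem exists_test (hA1 : AssumptionA1 G) (y : X) :
    ∃ H : BoundedContinuousFunction (X × JA A) ℝ, ∀ ρ : ProbabilityMeasure (X × JA A),
      (ρ : Measure (X × JA A)) (KK G)ᶜ = 0 →
      ((ρ : Measure (X × JA A)) (Prod.fst ⁻¹' {y}) = ENNReal.ofReal (1 - G.α) * G.η {y} +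
        ENNReal.ofReal G.α * ∫⁻ q, G.p q.1 q.2 {y} ∂(ρ : Measure (X × JA A)) ↔
       ∫ q, H q ∂(ρ : Measure (X × JA A)) = (1 - G.α) * (G.η {y}).toReal) := by
  classical
  have h0 := G.hα0
  have h1 := G.hα1
  have hη := G.hη
  have hpr := G.hp
  have hle : ∀ q : X × JA A, G.p q.1 q.2 {y} ≤ 1 := fun q => prob_le_one
  have hc : Continuous fun q : KK G => (G.p q.1.1 q.1.2 {y}).toReal := by
    have := (continuousOn_p G hA1 y).domRestrict
    refine continuous_iff_continuousAt.2 fun q => ?_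
    exact (ENNReal.tendsto_toReal (measure_ne_top _ _)).comp this.continuousAt
  let f : BoundedContinuousFunction (KK G) ℝ := BoundedContinuousFunction.ofNormedAddCommGroup
    (fun q : KK G => (G.p q.1.1 q.1.2 {y}).toReal) hc 1 (fun q => by
      rw [Real.norm_of_nonneg ENNReal.toReal_nonneg]
      exact ENNReal.toReal_le_of_le_ofReal zero_le_one (by simpa using hle q.1))
  obtain ⟨g, -, hg⟩ := BoundedContinuousFunction.exists_norm_eq_domRestrict_eq_of_closed f (isClosed_KK G)
  have hg' : ∀ q ∈ KK G, g q = (G.p q.1 q.2 {y}).toReal := fun q hq => by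
    have := congrArg (fun u => u ⟨q, hq⟩) hg
    exact this
  have hi : Continuous fun q : X × JA A => if q.1 = y then (1 : ℝ) else 0 :=
    (continuous_of_discreteTopology (f := fun x : X => if x = y then (1 : ℝ) else 0)).comp continuous_fst
  let b : BoundedContinuousFunction (X × JA A) ℝ := BoundedContinuousFunction.ofNormedAddCommGroup
    _ hi 1 (fun q => by split_ifs <;> simp)
  refine ⟨b - G.α • g, fun ρ hρ => ?_⟩
  have hk : ∀ᵐ q ∂(ρ : Measure (X × JA A)), q ∈ KK G := hρ
  have i1 : ∫ q, b q ∂(ρ : Measure (X × JA A)) =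
      ((ρ : Measure (X × JA A)) (Prod.fst ⁻¹' {y})).toReal := by
    have hms : MeasurableSet (Prod.fst ⁻¹' {y} : Set (X × JA A)) := measurable_fst (MeasurableSet.singleton y)
    rw [← Measure.real, ← integral_indicator_one hms]
    refine integral_congr_ae (Eventually.of_forall fun q => ?_)
    show (if q.1 = y then (1 : ℝ) else 0) = _
    simp [Set.indicator_apply]
  have i2 : ∫ q, g q ∂(ρ : Measure (X × JA A)) =
      (∫⁻ q, G.p q.1 q.2 {y} ∂(ρ : Measure (X × JA A))).toReal := by
    rw [← integral_toReal]
    · refine integral_congr_ae ?_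
      filter_upwards [hk] with q hq
      exact hg' q hq
    · exact ((Measure.measurable_coe (MeasurableSet.singleton y)).comp (measurable_p_s4 G)).aemeasurable
    · exact Eventually.of_forall fun q => (hle q).trans_lt ENNReal.one_lt_top
  have hfin : ∫⁻ q, G.p q.1 q.2 {y} ∂(ρ : Measure (X × JA A)) ≠ ⊤ := by
    refine ne_top_of_le_ne_top ENNReal.one_ne_top ((lintegral_mono hle).trans ?_)
    simp
  have i3 : ∫ q, (b - G.α • g) q ∂(ρ : Measure (X × JA A)) =
      ((ρ : Measure (X × JA A)) (Prod.fst ⁻¹' {y})).toReal - 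
        G.α * (∫⁻ q, G.p q.1 q.2 {y} ∂(ρ : Measure (X × JA A))).toReal := by
    rw [← i1, ← i2, ← integral_const_mul, ← integral_sub (b.integrable _) ((g.integrable _).const_mul _)]
    rfl
  rw [i3, ← ENNReal.toReal_eq_toReal_iff' (measure_ne_top _ _)
    (ENNReal.add_ne_top.2 ⟨ENNReal.mul_ne_top ENNReal.ofReal_ne_top (measure_ne_top _ _),
      ENNReal.mul_ne_top ENNReal.ofReal_ne_top hfin⟩),
    ENNReal.toReal_add (ENNReal.mul_ne_top ENNReal.ofReal_ne_top (measure_ne_top _ _))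
      (ENNReal.mul_ne_top ENNReal.ofReal_ne_top hfin), ENNReal.toReal_mul, ENNReal.toReal_mul,
    ENNReal.toReal_ofReal h0.le, ENNReal.toReal_ofReal (by linarith), sub_eq_iff_eq_add]

theorem occ_closed (hA1 : AssumptionA1 G) : IsClosed (OccSet G) := by
  refine isClosed_of_closure_subset fun ρ hρ => ?_
  have : (𝓝[OccSet G] ρ).NeBot := mem_closure_iff_nhdsWithin_neBot.1 hρ
  have hlim : Tendsto (fun μ : ProbabilityMeasure (X × JA A) => μ) (𝓝[OccSet G] ρ) (𝓝 ρ) :=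
    tendsto_id.mono_left nhdsWithin_le_nhds
  have hev : ∀ᶠ μ in 𝓝[OccSet G] ρ, μ ∈ OccSet G := eventually_mem_nhdsWithin
  have hs : (ρ : Measure (X × JA A)) (KK G)ᶜ = 0 := by
    have h := ProbabilityMeasure.le_liminf_measure_open_of_tendsto hlim (isClosed_KK G).isOpen_compl
    have h2 : (fun μ : ProbabilityMeasure (X × JA A) => (μ : Measure (X × JA A)) (KK G)ᶜ)
        =ᶠ[𝓝[OccSet G] ρ] fun _ => 0 := by
      filter_upwards [hev] with μ hμ
      exact ((mem_OccSet_iff G μ).1 hμ).1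
    rw [liminf_congr h2, liminf_const] at h
    exact le_antisymm h zero_le
  refine (mem_OccSet_iff G ρ).2 ⟨hs, bal_of_singleton G _ fun y => ?_⟩
  obtain ⟨H, hH⟩ := exists_test G hA1 y
  rw [hH ρ hs]
  have ht := (ProbabilityMeasure.tendsto_iff_forall_integral_tendsto.1 hlim) H
  refine tendsto_nhds_unique ht (tendsto_const_nhds.congr' ?_)
  filter_upwards [hev] with μ hμ
  have hm := (mem_OccSet_iff G μ).1 hμ
  exact ((hH μ hm.1).1 (bal_set G _ hm.2 {y})).symm

theorem occ_compact (hA1 : AssumptionA1 G) : IsCompact (OccSet G) := by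
  have := isCompact_closure_of_isTightMeasureSet (occ_tight G hA1)
  rwa [(occ_closed G hA1).closure_eq] at this

/-- Lemma 1. -/
theorem stmt4 (hA1 : AssumptionA1 G) :
    (∀ ρ₁ ∈ OccSet G, ∀ ρ₂ ∈ OccSet G, ∀ θ : ℝ, 0 ≤ θ → θ ≤ 1 →
      ∃ ρ ∈ OccSet G, (ρ : Measure (X × JA A)) =
        ENNReal.ofReal θ • (ρ₁ : Measure (X × JA A)) +
          ENNReal.ofReal (1 - θ) • (ρ₂ : Measure (X × JA A))) ∧
    IsCompact (OccSet G) := by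
  exact ⟨occ_convex G, occ_compact G hA1⟩


end CSGame
end
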